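/- arXiv:2209.14153 — 4 statements merged into one kernel-verified Lean document; each statement's English description precedes it below -/
import Mathlib

section
/- Let n ≥ 2 and let Ω ⊂ ℝⁿ be a bounded open convex set with C¹ boundary, with outward unit normal ν. Then ∫_{∂Ω} ∫_{∂Ω} |⟨ν(x), y − x⟩ · ⟨y − x, ν(y)⟩| / ‖x − y‖^{n+1} dσ(x) dσ(y) = c_n · σ(∂Ω), where c_n = (1/2) ∫_{S^{n−1}} |w₁| dσ(w). -/
open MeasureTheory RealInnerProductSpace

section

open Module Set Filter Topology
open scoped NNReal ENNReal

section AreaFormula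

theorem hausdorffMeasure_image_le_of_edist_le {X Y Z : Type*} [EMetricSpace Y] [EMetricSpace Z]
    [MeasurableSpace Y] [BorelSpace Y] [MeasurableSpace Z] [BorelSpace Z]
    {f : X → Y} {g : X → Z} {s : Set X} {K : ℝ≥0} {d : ℝ} (hd : 0 ≤ d)
    (h : ∀ a ∈ s, ∀ b ∈ s, edist (f a) (f b) ≤ K * edist (g a) (g b)) :
    μH[d] (f '' s) ≤ (K : ℝ≥0∞) ^ d * μH[d] (g '' s) := by
  rcases isEmpty_or_nonempty X with hX | hX
  · simp [Set.eq_empty_of_isEmpty s]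
  set k := Function.invFunOn g s
  have hk : ∀ a ∈ s, k (g a) ∈ s ∧ g (k (g a)) = g a := fun a ha =>
    ⟨Function.invFunOn_mem ⟨a, ha, rfl⟩, Function.invFunOn_eq ⟨a, ha, rfl⟩⟩
  have himg : f '' s = (f ∘ k) '' (g '' s) := by
    rw [Set.image_image]
    refine Set.image_congr fun a ha => ?_
    have := h a ha _ (hk a ha).1
    rw [(hk a ha).2, edist_self, mul_zero] at this
    exact edist_le_zero.1 this
  rw [himg]
  refine LipschitzOnWith.hausdorffMeasure_image_le ?_ hd
  rintro _ ⟨a, ha, rfl⟩ _ ⟨b, hb, rfl⟩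
  simpa [(hk a ha).2, (hk b hb).2] using h _ (hk a ha).1 _ (hk b hb).1

theorem measure_le_smul_of_locally {X : Type*} [TopologicalSpace X] [SecondCountableTopology X]
    [MeasurableSpace X] [OpensMeasurableSpace X] {ρ μ : Measure X} {C : ℝ≥0∞}
    (h : ∀ x, ∃ U ∈ 𝓝 x, ∀ s ⊆ U, MeasurableSet s → ρ s ≤ C * μ s)
    {s : Set X} (hs : MeasurableSet s) : ρ s ≤ C * μ s := by
  have h' : ∀ x, ∃ U, IsOpen U ∧ x ∈ U ∧ ∀ s ⊆ U, MeasurableSet s → ρ s ≤ C * μ s := by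
    intro x
    obtain ⟨U, hU, hs⟩ := h x
    obtain ⟨V, hVU, hV, hx⟩ := mem_nhds_iff.1 hU
    exact ⟨V, hV, hx, fun s hsV => hs s (hsV.trans hVU)⟩
  choose U hUo hxU hU using h'
  rcases isEmpty_or_nonempty X with hX | hX
  · simp [Set.eq_empty_of_isEmpty s]
  obtain ⟨c, hc, hcU⟩ := TopologicalSpace.countable_cover_nhds fun x => (hUo x).mem_nhds (hxU x)
  have hne : c.Nonempty := by
    rcases c.eq_empty_or_nonempty with rfl | hne
    · exact absurd hcU.symm (by simp)
    · exact hne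
  obtain ⟨e, rfl⟩ := hc.exists_eq_range hne
  rw [biUnion_range] at hcU
  set V := disjointed fun n => U (e n)
  have hVm : ∀ n, MeasurableSet (V n) :=
    fun n => MeasurableSet.disjointed (fun n => (hUo (e n)).measurableSet) n
  have hVd : Pairwise (Function.onFun Disjoint fun n => s ∩ V n) := fun i j hij =>
    (disjoint_disjointed _ hij).mono inter_subset_right inter_subset_right
  have hsV : s = ⋃ n, s ∩ V n := by
    rw [← inter_iUnion, iUnion_disjointed, hcU, inter_univ]
  rw [hsV, measure_iUnion hVd fun n => hs.inter (hVm n),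
    measure_iUnion hVd fun n => hs.inter (hVm n), ← ENNReal.tsum_mul_left]
  exact ENNReal.tsum_le_tsum fun n =>
    hU (e n) _ (inter_subset_right.trans (disjointed_subset _ n)) (hs.inter (hVm n))

variable {E F : Type*} [NormedAddCommGroup E] [InnerProductSpace ℝ E] [FiniteDimensional ℝ E]
  [NormedAddCommGroup F] [InnerProductSpace ℝ F]

theorem continuous_normDet [FiniteDimensional ℝ F] :
    Continuous fun L : E →L[ℝ] F => L.toLinearMap.normDet := by
  have : (fun L : E →L[ℝ] F => L.toLinearMap.normDet) =
      fun L => √((L.adjoint ∘L L).det) := by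
    ext L
    rw [← L.normDet_sq]
    simp [Real.sqrt_sq L.toLinearMap.normDet_nonneg]
  rw [this]
  refine Real.continuous_sqrt.comp (ContinuousLinearMap.continuous_det.comp ?_)
  exact (ContinuousLinearMap.adjoint.continuous).clm_comp continuous_id

theorem normDet_pos {L : E →L[ℝ] F} (hL : Function.Injective L) : 0 < L.toLinearMap.normDet := by
  refine lt_of_le_of_ne L.toLinearMap.normDet_nonneg (Ne.symm fun h => ?_)
  exact (LinearMap.normDet_eq_zero_iff_ker_ne_bot.1 h) (LinearMap.ker_eq_bot.2 hL)

variable [MeasurableSpace E] [BorelSpace E]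

theorem ContDiff.measurable_normDet_fderiv [FiniteDimensional ℝ F] {Φ : E → F}
    (hΦ : ContDiff ℝ 1 Φ) :
    Measurable fun x => ENNReal.ofReal (fderiv ℝ Φ x).toLinearMap.normDet :=
  (continuous_normDet.comp (hΦ.continuous_fderiv one_ne_zero)).measurable.ennreal_ofReal

variable [MeasurableSpace F] [BorelSpace F]

theorem HasStrictFDerivAt.exists_nhds_hausdorffMeasure_image {Φ : E → F} {L : E →L[ℝ] F} {x : E}
    (hΦ : HasStrictFDerivAt Φ L x) (hL : Function.Injective L) {K : ℝ≥0} (hK : 1 < K) :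
    ∃ U ∈ 𝓝 x, ∀ s ⊆ U,
      μH[finrank ℝ E] (Φ '' s) ≤
        K ^ finrank ℝ E * (ENNReal.ofReal L.toLinearMap.normDet * μH[finrank ℝ E] s) ∧
      ENNReal.ofReal L.toLinearMap.normDet * μH[finrank ℝ E] s ≤
        K ^ finrank ℝ E * μH[finrank ℝ E] (Φ '' s) := by
  obtain ⟨A, hA, hAL⟩ := (L : E →ₗ[ℝ] F).exists_antilipschitzWith (LinearMap.ker_eq_bot.2 hL)
  have hK0 : (0 : ℝ) < K := by positivity
  have hK1 : (1 : ℝ) < K := by exact_mod_cast hK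
  have hA0 : (0 : ℝ) < A := by exact_mod_cast hA
  have hcpos : (0 : ℝ) < (1 - 1 / K) / A := by
    refine div_pos (sub_pos.2 ?_) hA0
    rw [div_lt_one hK0]; exact hK1
  obtain ⟨U, hU, hUa⟩ := hΦ.approximates_deriv_on_nhds
    (c := ⟨(1 - 1 / K) / A, hcpos.le⟩) (Or.inr hcpos)
  have key : ∀ a ∈ U, ∀ b ∈ U, ‖Φ a - Φ b - (L a - L b)‖ ≤ (1 - 1 / K) * ‖L a - L b‖ := by
    intro a ha b hb
    have h1 := hUa a ha b hb
    have h2 := hAL.le_mul_dist a b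
    rw [dist_eq_norm, dist_eq_norm] at h2
    rw [map_sub] at h1
    calc _ ≤ (1 - 1 / K) / A * ‖a - b‖ := h1
      _ ≤ (1 - 1 / K) / A * (A * ‖L a - L b‖) := by gcongr; exact h2
      _ = _ := by field_simp
  have hinv : (K : ℝ) * (1 / K) = 1 := by field_simp
  have hle : 2 - 1 / (K : ℝ) ≤ K := by
    nlinarith [sq_nonneg ((K : ℝ) - 1), one_div_pos.2 hK0]
  have toE : ∀ {y z : F} {y' z' : F}, ‖y - z‖ ≤ K * ‖y' - z'‖ →
      edist y z ≤ K * edist y' z' := by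
    intro y z y' z' h
    rw [edist_dist, edist_dist, dist_eq_norm, dist_eq_norm, ← ENNReal.ofReal_coe_nnreal,
      ← ENNReal.ofReal_mul hK0.le]
    exact ENNReal.ofReal_le_ofReal h
  refine ⟨U, hU, fun s hs => ?_⟩
  rw [← LinearMap.hausdorffMeasure_image]
  constructor
  · have := hausdorffMeasure_image_le_of_edist_le (f := Φ) (g := L) (s := s) (K := K)
      (d := finrank ℝ E) (by positivity) fun a ha b hb => toE <| by
        have h1 := key a (hs ha) b (hs hb)
        have h2 := norm_sub_norm_le (Φ a - Φ b) (L a - L b)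
        nlinarith [norm_nonneg (L a - L b)]
    simpa using this
  · have := hausdorffMeasure_image_le_of_edist_le (f := L) (g := Φ) (s := s) (K := K)
      (d := finrank ℝ E) (by positivity) fun a ha b hb => toE <| by
        have h1 := key a (hs ha) b (hs hb)
        have h2 := norm_sub_norm_le (L a - L b) (Φ a - Φ b)
        rw [norm_sub_rev (L a - L b)] at h2
        have h3 : 1 / (K : ℝ) * ‖L a - L b‖ ≤ ‖Φ a - Φ b‖ := by linarith
        calc _ = K * (1 / K * ‖L a - L b‖) := by rw [← mul_assoc, hinv, one_mul]
          _ ≤ _ := by gcongr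
    simpa using this

theorem le_of_forall_one_lt_le_pow_mul {a b : ℝ≥0∞} (m : ℕ)
    (h : ∀ K : ℝ≥0, 1 < K → a ≤ K ^ m * b) : a ≤ b := by
  have ht : Tendsto (fun K : ℝ≥0 => (K : ℝ≥0∞) ^ m * b) (𝓝[>] 1) (𝓝 (1 * b)) := by
    refine ENNReal.Tendsto.mul_const ?_ (Or.inl one_ne_zero)
    refine tendsto_nhdsWithin_of_tendsto_nhds ?_
    have : Continuous fun K : ℝ≥0 => (K : ℝ≥0∞) ^ m :=
      (ENNReal.continuous_pow m).comp ENNReal.continuous_coe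
    simpa using this.tendsto 1
  rw [one_mul] at ht
  exact ge_of_tendsto ht (eventually_nhdsWithin_of_forall h)

variable [FiniteDimensional ℝ F]

/-- **Area formula** for injective `C¹` immersions. -/
theorem comap_hausdorffMeasure_eq_withDensity {Φ : E → F} (hΦ : ContDiff ℝ 1 Φ)
    (hinj : Function.Injective Φ) (himm : ∀ x, Function.Injective (fderiv ℝ Φ x)) :
    (μH[finrank ℝ E] : Measure F).comap Φ =
      (μH[finrank ℝ E] : Measure E).withDensity
        fun x => ENNReal.ofReal (fderiv ℝ Φ x).toLinearMap.normDet := by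
  set m := finrank ℝ E
  set J : E → ℝ := fun x => (fderiv ℝ Φ x).toLinearMap.normDet
  have hJc : Continuous J := continuous_normDet.comp (hΦ.continuous_fderiv one_ne_zero)
  have hJ0 : ∀ x, 0 < J x := fun x => normDet_pos (himm x)
  have hemb : MeasurableEmbedding Φ := hΦ.continuous.measurableEmbedding hinj
  have hloc : ∀ K : ℝ≥0, 1 < K → ∀ x, ∃ U ∈ 𝓝 x, ∀ s ⊆ U, MeasurableSet s →
      μH[m] (Φ '' s) ≤ K ^ (m + 1) * ∫⁻ y in s, ENNReal.ofReal (J y) ∂μH[m] ∧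
      ∫⁻ y in s, ENNReal.ofReal (J y) ∂μH[m] ≤ K ^ (m + 1) * μH[m] (Φ '' s) := by
    intro K hK x
    have hK1 : (1 : ℝ) < K := by exact_mod_cast hK
    obtain ⟨U, hU, h⟩ := (hΦ.contDiffAt.hasStrictFDerivAt
      one_ne_zero).exists_nhds_hausdorffMeasure_image (himm x) hK
    have hx := hJ0 x
    have e1 : ∀ᶠ y in 𝓝 x, J x < K * J y :=
      (continuous_const.mul hJc).tendsto x |>.eventually_const_lt (lt_mul_left hx hK1)
    have e2 : ∀ᶠ y in 𝓝 x, J y < K * J x := hJc.tendsto x |>.eventually_lt_const (by nlinarith)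
    have ofR : ∀ {a b : ℝ}, a < K * b → ENNReal.ofReal a ≤ K * ENNReal.ofReal b := by
      intro a b hab
      rw [← ENNReal.ofReal_coe_nnreal, ← ENNReal.ofReal_mul K.coe_nonneg]
      exact ENNReal.ofReal_le_ofReal hab.le
    refine ⟨U ∩ {y | J x < K * J y ∧ J y < K * J x}, inter_mem hU (e1.and e2),
      fun s hs hsm => ?_⟩
    obtain ⟨h1, h2⟩ := h s (hs.trans inter_subset_left)
    have hconst : ENNReal.ofReal (J x) * μH[m] s = ∫⁻ y in s, ENNReal.ofReal (J x) ∂μH[m] := by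
      simp
    constructor
    · calc _ ≤ _ := h1
        _ ≤ K ^ m * ∫⁻ y in s, K * ENNReal.ofReal (J y) ∂μH[m] := by
          rw [hconst]
          gcongr K ^ m * ?_
          exact setLIntegral_mono' hsm fun y hy => ofR (hs hy).2.1
        _ = _ := by rw [lintegral_const_mul _ hJc.measurable.ennreal_ofReal, pow_succ, mul_assoc]
    · calc _ ≤ ∫⁻ y in s, K * ENNReal.ofReal (J x) ∂μH[m] :=
          setLIntegral_mono' hsm fun y hy => ofR (hs hy).2.2
        _ = K * (ENNReal.ofReal (J x) * μH[m] s) := by simp [mul_assoc]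
        _ ≤ K * (K ^ m * μH[m] (Φ '' s)) := by gcongr
        _ = _ := by rw [pow_succ' _ m, mul_assoc]
  ext s hs
  apply le_antisymm
  · refine le_of_forall_one_lt_le_pow_mul (m + 1) fun K hK => ?_
    refine measure_le_smul_of_locally (fun x => ?_) hs
    obtain ⟨U, hU, h⟩ := hloc K hK x
    refine ⟨U, hU, fun s hsU hs => ?_⟩
    rw [hemb.comap_apply, withDensity_apply _ hs]
    exact (h s hsU hs).1
  · refine le_of_forall_one_lt_le_pow_mul (m + 1) fun K hK => ?_
    refine measure_le_smul_of_locally (fun x => ?_) hs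
    obtain ⟨U, hU, h⟩ := hloc K hK x
    refine ⟨U, hU, fun s hsU hs => ?_⟩
    rw [hemb.comap_apply, withDensity_apply _ hs]
    exact (h s hsU hs).2

theorem setIntegral_range_hausdorffMeasure {Φ : E → F} (hΦ : ContDiff ℝ 1 Φ)
    (hinj : Function.Injective Φ) (himm : ∀ x, Function.Injective (fderiv ℝ Φ x)) (g : F → ℝ) :
    ∫ y in range Φ, g y ∂μH[finrank ℝ E] =
      ∫ x, (fderiv ℝ Φ x).toLinearMap.normDet * g (Φ x) ∂μH[finrank ℝ E] := by
  have hemb : MeasurableEmbedding Φ := hΦ.continuous.measurableEmbedding hinj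
  rw [← hemb.map_comap, hemb.integral_map, comap_hausdorffMeasure_eq_withDensity hΦ hinj himm,
    integral_withDensity_eq_integral_toReal_smul hΦ.measurable_normDet_fderiv (by simp)]
  simp [LinearMap.normDet_nonneg]

end AreaFormula

section NormDet

variable {E F : Type*} [NormedAddCommGroup E] [InnerProductSpace ℝ E]
  [NormedAddCommGroup F] [InnerProductSpace ℝ F]

theorem injective_of_eq_smul_add {ι : E →ₗᵢ[ℝ] F} {L : E →ₗ[ℝ] F} {a : ℝ} {ℓ : E → ℝ} {u N : F}
    (ha : a ≠ 0) (hιN : ∀ h, ⟪N, ι h⟫ = 0) (huN : ⟪u, N⟫ = -1)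
    (hL : ∀ h, L h = ℓ h • u + a • ι h) : Function.Injective L := by
  refine (injective_iff_map_eq_zero L).2 fun h hh => ?_
  have h0 : ℓ h = 0 := by
    have := congrArg (inner ℝ N) ((hL h).symm.trans hh)
    rw [inner_add_right, inner_smul_right, inner_smul_right, hιN, real_inner_comm, huN,
      inner_zero_right] at this
    linarith
  rw [hL, h0, zero_smul, zero_add, smul_eq_zero_iff_right ha] at hh
  exact ι.injective (hh.trans (map_zero ι).symm)

variable [FiniteDimensional ℝ E] [FiniteDimensional ℝ F]

theorem normDet_projection_comp_linearIsometry {ι : E →ₗᵢ[ℝ] F} {ν w : F} (hν : ‖ν‖ = 1)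
    (hw : ‖w‖ = 1) (hιν : ∀ b, ⟪ν, ι b⟫ = 0) (hι : ∀ z, ⟪ν, z⟫ = 0 → ∃ b, ι b = z)
    {P : F →ₗ[ℝ] F} (hP : ∀ z, P z = z - ⟪w, z⟫ • w) :
    (P ∘ₗ ι.toLinearMap).normDet = |⟪w, ν⟫| := by
  have hνν : ⟪ν, ν⟫ = 1 := by rw [real_inner_self_eq_norm_sq, hν, one_pow]
  have hww : ⟪w, w⟫ = 1 := by rw [real_inner_self_eq_norm_sq, hw, one_pow]
  obtain ⟨b, hb⟩ := hι (w - ⟪w, ν⟫ • ν) (by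
    rw [inner_sub_right, inner_smul_right, hνν, real_inner_comm w ν]; ring)
  have hwι : ∀ x, ⟪w, ι x⟫ = ⟪b, x⟫ := by
    intro x
    rw [← ι.inner_map_map b x, hb, inner_sub_left, inner_smul_left, hιν, mul_zero, sub_zero]
  have hbb : ⟪b, b⟫ = 1 - ⟪w, ν⟫ ^ 2 := by
    rw [← ι.inner_map_map b b, hb]
    simp only [inner_sub_left, inner_sub_right, inner_smul_left, inner_smul_right, hνν, hww,
      real_inner_comm w ν, RCLike.conj_to_real]
    ring
  have hadj : (P ∘ₗ ι.toLinearMap).adjoint ∘ₗ (P ∘ₗ ι.toLinearMap) =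
      LinearMap.transvection (-(innerSL ℝ b).toLinearMap) b := by
    ext x
    refine ext_inner_right ℝ fun y => ?_
    rw [LinearMap.comp_apply, LinearMap.adjoint_inner_left]
    simp only [LinearMap.comp_apply, LinearIsometry.coe_toLinearMap, hP, inner_sub_left,
      inner_sub_right, inner_smul_left, inner_smul_right, hww, hwι, real_inner_comm w,
      ι.inner_map_map, LinearMap.transvection.apply, inner_add_left, RCLike.conj_to_real,
      LinearMap.neg_apply, ContinuousLinearMap.coe_coe, innerSL_apply_apply]
    ring
  have hsq := (P ∘ₗ ι.toLinearMap).normDet_sq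
  rw [hadj, LinearMap.transvection.det] at hsq
  rw [← abs_of_nonneg (LinearMap.normDet_nonneg (P ∘ₗ ι.toLinearMap)), ← sq_eq_sq_iff_abs_eq_abs]
  simp only [LinearMap.neg_apply, ContinuousLinearMap.coe_coe, innerSL_apply_apply, hbb] at hsq
  simpa using hsq

theorem normDet_projection_comp {L : E →ₗ[ℝ] F} {ν w : F} (hν : ‖ν‖ = 1) (hw : ‖w‖ = 1)
    (hdim : finrank ℝ F = finrank ℝ E + 1) (hL : Function.Injective L)
    (hLν : ∀ h, ⟪ν, L h⟫ = 0) {P : F →ₗ[ℝ] F} (hP : ∀ z, P z = z - ⟪w, z⟫ • w) :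
    (P ∘ₗ L).normDet = |⟪w, ν⟫| * L.normDet := by
  have hle : L.range ≤ (ℝ ∙ ν)ᗮ := by
    rintro _ ⟨h, rfl⟩
    exact Submodule.mem_orthogonal_singleton_iff_inner_right.2 (hLν h)
  have hrange : L.range = (ℝ ∙ ν)ᗮ := by
    refine Submodule.eq_of_le_of_finrank_eq hle ?_
    have h1 := Submodule.finrank_add_finrank_orthogonal (ℝ ∙ ν)
    rw [finrank_span_singleton (by rintro rfl; simp at hν)] at h1
    rw [LinearMap.finrank_range_of_inj hL]
    omega
  rw [LinearMap.normDet_comp, LinearMap.domRestrict]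
  congr 1
  refine normDet_projection_comp_linearIsometry (ι := L.range.subtypeₗᵢ) hν hw ?_ ?_ hP
  · rintro ⟨_, h, rfl⟩
    exact hLν h
  · intro z hz
    exact ⟨⟨z, hrange ▸ Submodule.mem_orthogonal_singleton_iff_inner_right.2 hz⟩, rfl⟩

/-- Adding to `a • ι` a map with values in the line `ℝ u` does not change the volume of the
image transverse to `u`. -/
theorem normDet_mul_abs_inner {ι : E →ₗᵢ[ℝ] F} {L : E →ₗ[ℝ] F} {a : ℝ} {ℓ : E → ℝ} {u N ν : F}
    (hN : ‖N‖ = 1) (hν : ‖ν‖ = 1) (hdim : finrank ℝ F = finrank ℝ E + 1) (ha : 0 < a)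
    (hιN : ∀ h, ⟪N, ι h⟫ = 0) (huN : ⟪u, N⟫ = -1) (hL : ∀ h, L h = ℓ h • u + a • ι h)
    (hLν : ∀ h, ⟪ν, L h⟫ = 0) :
    L.normDet * |⟪u, ν⟫| = a ^ finrank ℝ E := by
  have hinj := injective_of_eq_smul_add ha.ne' hιN huN hL
  have hu : u ≠ 0 := by rintro rfl; simp at huN
  have hu0 : 0 < ‖u‖ := norm_pos_iff.2 hu
  set w := ‖u‖⁻¹ • u with hw_def
  have hw : ‖w‖ = 1 := by
    rw [norm_smul, norm_inv, norm_norm, inv_mul_cancel₀ hu0.ne']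
  have huw : u = ‖u‖ • w := by rw [hw_def, smul_smul, mul_inv_cancel₀ hu0.ne', one_smul]
  have hww : ⟪w, w⟫ = 1 := by rw [real_inner_self_eq_norm_sq, hw, one_pow]
  let P : F →ₗ[ℝ] F := LinearMap.id - (innerSL ℝ w).toLinearMap.smulRight w
  have hP : ∀ z, P z = z - ⟪w, z⟫ • w := fun z => by simp [P]
  have hPu : P u = 0 := by
    rw [huw, map_smul, hP, hww, one_smul, sub_self, smul_zero]
  have hPL : P ∘ₗ L = a • (P ∘ₗ ι.toLinearMap) := by
    ext h
    simp [hL, hPu]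
  have h1 := normDet_projection_comp hν hw hdim hinj hLν hP
  have h2 := normDet_projection_comp hN hw hdim ι.injective hιN hP
  rw [hPL, LinearMap.normDet_smul, h2, LinearIsometry.normDet_eq_one, mul_one, Real.norm_eq_abs,
    abs_of_pos ha] at h1
  have h3 : ‖u‖ * |⟪w, N⟫| = 1 := by
    have := congrArg abs huN
    rwa [huw, inner_smul_left, abs_mul, abs_neg, abs_one, RCLike.conj_to_real, abs_norm] at this
  have h4 : |⟪u, ν⟫| = ‖u‖ * |⟪w, ν⟫| := by
    conv_lhs => rw [huw, inner_smul_left, abs_mul, RCLike.conj_to_real, abs_norm]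
  rw [h4]
  linear_combination (-‖u‖) * h1 + a ^ finrank ℝ E * h3

end NormDet

section CentralProjection

variable {E F : Type*} [NormedAddCommGroup E] [InnerProductSpace ℝ E]
  [NormedAddCommGroup F] [InnerProductSpace ℝ F] {ι : E →ₗᵢ[ℝ] F} {N : F}

theorem inner_sub_normal (hN : ‖N‖ = 1) (hιN : ∀ h, ⟪N, ι h⟫ = 0) (v : E) :
    ⟪N, ι v - N⟫ = -1 := by
  rw [inner_sub_right, hιN, real_inner_self_eq_norm_sq, hN]; norm_num

theorem norm_sub_normal_pos (hN : ‖N‖ = 1) (hιN : ∀ h, ⟪N, ι h⟫ = 0) (v : E) :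
    0 < ‖ι v - N‖ := by
  refine norm_pos_iff.2 fun h => ?_
  have := inner_sub_normal hN hιN v
  rw [h, inner_zero_right] at this
  norm_num at this

theorem exists_smul_sub_normal_eq (hι : ∀ z, ⟪N, z⟫ = 0 → ∃ b, ι b = z) (hN : ‖N‖ = 1)
    {z : F} (hz : ⟪N, z⟫ < 0) : ∃ v, ∃ t : ℝ, 0 < t ∧ t • (ι v - N) = z := by
  have hNN : ⟪N, N⟫ = 1 := by rw [real_inner_self_eq_norm_sq, hN, one_pow]
  obtain ⟨v, hv⟩ := hι ((-⟪N, z⟫)⁻¹ • z + N) (by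
    rw [inner_add_right, inner_smul_right, hNN, inv_neg, neg_mul, inv_mul_cancel₀ hz.ne]
    norm_num)
  refine ⟨v, -⟪N, z⟫, neg_pos.2 hz, ?_⟩
  rw [hv, add_sub_cancel_right, smul_smul, mul_inv_cancel₀ (neg_pos.2 hz).ne', one_smul]

theorem inner_fderiv_eq_zero_of_norm_eq_one {Φ : E → F} (hΦ : Differentiable ℝ Φ)
    (hnorm : ∀ v, ‖Φ v‖ = 1) (v h : E) : ⟪Φ v, fderiv ℝ Φ v h⟫ = 0 := by
  have h1 := (hΦ v).hasFDerivAt.norm_sq.unique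
    ((hasFDerivAt_const (1 : ℝ) v).congr_of_eventuallyEq
      (Eventually.of_forall fun w => by simp only [hnorm w, one_pow]))
  simpa using DFunLike.congr_fun h1 h

variable [FiniteDimensional ℝ E] [MeasurableSpace E] [BorelSpace E]
  [FiniteDimensional ℝ F] [MeasurableSpace F] [BorelSpace F]

/-- Integral of the interaction kernel over a hypersurface which is a radial graph, seen from the
point `c`, over the open half space `⟪N, ·⟫ < 0`: the value does not depend on the hypersurface. -/
theorem setIntegral_interaction_radialGraph (hdim : finrank ℝ F = finrank ℝ E + 1) (hN : ‖N‖ = 1)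
    (hιN : ∀ h, ⟪N, ι h⟫ = 0) {a : E → ℝ} (ha : ContDiff ℝ 1 a) (ha0 : ∀ v, 0 < a v) (c : F)
    {ν : F → F} (hν : ∀ v, ‖ν (c + a v • (ι v - N))‖ = 1)
    (hνΦ : ∀ v h, ⟪ν (c + a v • (ι v - N)), fderiv ℝ (fun v => c + a v • (ι v - N)) v h⟫ = 0) :
    ∫ y in range (fun v => c + a v • (ι v - N)),
        |⟪N, y - c⟫ * ⟪y - c, ν y⟫| / ‖c - y‖ ^ (finrank ℝ E + 2) ∂μH[finrank ℝ E] =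
      ∫ v, 1 / ‖ι v - N‖ ^ (finrank ℝ E + 2) ∂(μH[finrank ℝ E] : Measure E) := by
  set Φ : E → F := fun v => c + a v • (ι v - N)
  set m := finrank ℝ E
  have hΦ : ContDiff ℝ 1 Φ :=
    contDiff_const.add (ha.smul (ι.toContinuousLinearMap.contDiff.sub contDiff_const))
  have hΦ' : ∀ v h, fderiv ℝ Φ v h = fderiv ℝ a v h • (ι v - N) + a v • ι h := by
    intro v h
    have h1 : HasFDerivAt (fun v => ι v - N) ι.toContinuousLinearMap v :=
      ι.toContinuousLinearMap.hasFDerivAt.sub_const N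
    have h2 := ((((ha.differentiable one_ne_zero) v).hasFDerivAt.smul h1).const_add c).fderiv
    rw [show fderiv ℝ Φ v = _ from h2]
    simp [add_comm]
  have hu := inner_sub_normal hN hιN
  have hu' : ∀ v, ⟪ι v - N, N⟫ = -1 := fun v => by rw [real_inner_comm, hu v]
  have hinj : Function.Injective Φ := by
    intro v w hvw
    have hvw : a v • (ι v - N) = a w • (ι w - N) := add_left_cancel hvw
    have haa : a v = a w := by
      have := congrArg (inner ℝ N) hvw
      rw [inner_smul_right, inner_smul_right, hu, hu] at this
      linarith
    rw [haa] at hvw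
    exact ι.injective (sub_left_injective (smul_right_injective F (ha0 w).ne' hvw))
  have himm : ∀ v, Function.Injective (fderiv ℝ Φ v) := fun v =>
    injective_of_eq_smul_add (L := (fderiv ℝ Φ v).toLinearMap) (ha0 v).ne' hιN (hu' v) (hΦ' v)
  rw [setIntegral_range_hausdorffMeasure hΦ hinj himm]
  congr 1 with v
  have hJ : (fderiv ℝ Φ v).toLinearMap.normDet * |⟪ι v - N, ν (Φ v)⟫| = a v ^ m :=
    normDet_mul_abs_inner hN (hν v) hdim (ha0 v) hιN (hu' v) (hΦ' v) (hνΦ v)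
  have hpos := norm_sub_normal_pos hN hιN v
  have hav := ha0 v
  have e1 : Φ v - c = a v • (ι v - N) := add_sub_cancel_left _ _
  have e2 : ‖c - Φ v‖ = a v * ‖ι v - N‖ := by
    rw [norm_sub_rev, e1, norm_smul, Real.norm_of_nonneg hav.le]
  rw [e1, e2, inner_smul_right, inner_smul_left, hu, RCLike.conj_to_real, abs_mul, abs_mul, abs_mul,
    abs_neg, abs_one, abs_of_pos hav]
  rw [mul_pow, pow_add (a v), ← hJ]
  have hne : |⟪ι v - N, ν (Φ v)⟫| ≠ 0 := fun h => by
    rw [h, mul_zero] at hJ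
    exact (pow_pos hav _).ne hJ
  have hne' : (fderiv ℝ Φ v).toLinearMap.normDet ≠ 0 := (normDet_pos (himm v)).ne'
  field_simp

theorem setIntegral_abs_inner_halfSphere (hdim : finrank ℝ F = finrank ℝ E + 1) (hN : ‖N‖ = 1)
    (hιN : ∀ h, ⟪N, ι h⟫ = 0) (hι : ∀ z, ⟪N, z⟫ = 0 → ∃ b, ι b = z) :
    ∫ w in Metric.sphere (0 : F) 1 ∩ {w | ⟪N, w⟫ < 0}, |⟪N, w⟫| ∂μH[finrank ℝ E] =
      ∫ v, 1 / ‖ι v - N‖ ^ (finrank ℝ E + 2) ∂(μH[finrank ℝ E] : Measure E) := by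
  have hpos := norm_sub_normal_pos hN hιN
  have ha : ContDiff ℝ 1 fun v => ‖ι v - N‖⁻¹ :=
    ((ι.toContinuousLinearMap.contDiff.sub contDiff_const).norm ℝ
      fun v => norm_pos_iff.1 (hpos v)).inv fun v => (hpos v).ne'
  have hnorm : ∀ v, ‖(0 : F) + ‖ι v - N‖⁻¹ • (ι v - N)‖ = 1 := fun v => by
    rw [zero_add, norm_smul, norm_inv, norm_norm, inv_mul_cancel₀ (hpos v).ne']
  have hΦ : ContDiff ℝ 1 fun v => (0 : F) + ‖ι v - N‖⁻¹ • (ι v - N) :=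
    contDiff_const.add (ha.smul (ι.toContinuousLinearMap.contDiff.sub contDiff_const))
  have h := setIntegral_interaction_radialGraph hdim hN hιN ha (fun v => inv_pos.2 (hpos v)) 0
    (ν := id) hnorm (inner_fderiv_eq_zero_of_norm_eq_one (hΦ.differentiable one_ne_zero) hnorm)
  rw [← h]
  have hrange : range (fun v => (0 : F) + ‖ι v - N‖⁻¹ • (ι v - N)) =
      Metric.sphere (0 : F) 1 ∩ {w | ⟪N, w⟫ < 0} := by
    ext w
    constructor
    · rintro ⟨v, rfl⟩
      refine ⟨by simpa using hnorm v, ?_⟩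
      simp only [zero_add, mem_ofPred_eq]
      rw [inner_smul_right, inner_sub_normal hN hιN]
      have := inv_pos.2 (hpos v)
      linarith
    · rintro ⟨hw, hNw⟩
      obtain ⟨v, t, ht, rfl⟩ := exists_smul_sub_normal_eq hι hN hNw
      refine ⟨v, ?_⟩
      simp only [zero_add]
      rw [mem_sphere_zero_iff_norm, norm_smul, Real.norm_of_nonneg ht.le] at hw
      rw [eq_inv_of_mul_eq_one_left hw]
  rw [hrange]
  have hneg : MeasurableSet {w : F | ⟪N, w⟫ < 0} := measurableSet_lt (by fun_prop) measurable_const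
  refine setIntegral_congr_fun (Metric.isClosed_sphere.measurableSet.inter hneg) ?_
  rintro w ⟨hw, -⟩
  rw [mem_sphere_zero_iff_norm] at hw
  simp [hw]

end CentralProjection

section Sphere

variable {F : Type*} [NormedAddCommGroup F] [InnerProductSpace ℝ F]
  [MeasurableSpace F] [BorelSpace F]

theorem setIntegral_abs_inner_sphere (d : ℝ) (N : F) :
    ∫ w in Metric.sphere (0 : F) 1, |⟪N, w⟫| ∂μH[d] =
      2 * ∫ w in Metric.sphere (0 : F) 1 ∩ {w | ⟪N, w⟫ < 0}, |⟪N, w⟫| ∂μH[d] := by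
  set S := Metric.sphere (0 : F) 1
  have hS : MeasurableSet S := Metric.isClosed_sphere.measurableSet
  have hm : Measurable fun w : F => ENNReal.ofReal |⟪N, w⟫| := by fun_prop
  have hneg : MeasurableSet {w : F | ⟪N, w⟫ < 0} := measurableSet_lt (by fun_prop) measurable_const
  have hpos : MeasurableSet {w : F | 0 < ⟪N, w⟫} := measurableSet_lt measurable_const (by fun_prop)
  have hlint : ∫⁻ w in S, ENNReal.ofReal |⟪N, w⟫| ∂μH[d] =
      2 * ∫⁻ w in S ∩ {w | ⟪N, w⟫ < 0}, ENNReal.ofReal |⟪N, w⟫| ∂μH[d] := by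
    have hsym : ∫⁻ w in S ∩ {w | 0 < ⟪N, w⟫}, ENNReal.ofReal |⟪N, w⟫| ∂μH[d] =
        ∫⁻ w in S ∩ {w | ⟪N, w⟫ < 0}, ENNReal.ofReal |⟪N, w⟫| ∂μH[d] := by
      have hmp :=
        (LinearIsometryEquiv.neg ℝ (E := F)).toIsometryEquiv.measurePreserving_hausdorffMeasure d
      rw [← hmp.setLIntegral_comp_preimage (hS.inter hneg) hm]
      have : (LinearIsometryEquiv.neg ℝ (E := F)).toIsometryEquiv ⁻¹' (S ∩ {w : F | ⟪N, w⟫ < 0}) =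
          S ∩ {w | 0 < ⟪N, w⟫} := by
        ext w; simp [S]
      rw [this]
      simp
    have hdiff : ∫⁻ w in S \ {w | ⟪N, w⟫ < 0}, ENNReal.ofReal |⟪N, w⟫| ∂μH[d] =
        ∫⁻ w in S ∩ {w | 0 < ⟪N, w⟫}, ENNReal.ofReal |⟪N, w⟫| ∂μH[d] := by
      rw [← lintegral_indicator (hS.diff hneg), ← lintegral_indicator (hS.inter hpos)]
      congr 1 with w
      by_cases hw : w ∈ S <;> rcases lt_trichotomy ⟪N, w⟫ 0 with h | h | h <;>
        simp [indicator, hw, h, h.not_gt]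
    rw [← lintegral_inter_add_sdiff _ S hneg, hdiff, hsym, two_mul]
  have h0 : ∀ μ : Measure F, ∫ w, |⟪N, w⟫| ∂μ = (∫⁻ w, ENNReal.ofReal |⟪N, w⟫| ∂μ).toReal :=
    fun μ => integral_eq_lintegral_of_nonneg_ae (Eventually.of_forall fun _ => abs_nonneg _)
      (by fun_prop)
  rw [h0, h0, hlint, ENNReal.toReal_mul, ENNReal.toReal_ofNat]

theorem setIntegral_abs_inner_sphere_eq_of_norm_eq (d : ℝ) {N N' : F} (h : ‖N‖ = ‖N'‖) :
    ∫ w in Metric.sphere (0 : F) 1, |⟪N, w⟫| ∂μH[d] =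
      ∫ w in Metric.sphere (0 : F) 1, |⟪N', w⟫| ∂μH[d] := by
  set R := (ℝ ∙ (N - N'))ᗮ.reflection
  have hR : R N = N' := Submodule.reflection_sub h
  have hmp := R.toIsometryEquiv.measurePreserving_hausdorffMeasure d
  rw [← hmp.setIntegral_preimage_emb R.toHomeomorph.measurableEmbedding
    (fun w => |⟪N', w⟫|) (Metric.sphere 0 1)]
  have : R.toIsometryEquiv ⁻¹' Metric.sphere (0 : F) 1 = Metric.sphere 0 1 := by
    ext w; simp
  rw [this]
  congr 1 with w
  rw [← hR]
  exact congrArg abs (R.inner_map_map N w).symm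

end Sphere

section ConvexSublevel

variable {F : Type*} [NormedAddCommGroup F] [InnerProductSpace ℝ F]
  {Ω : Set F} {f : F → ℝ}

theorem exists_pos_lt_add_smul_mem {x u : F} (hf : Differentiable ℝ f) (hΩf : Ω = {x | f x < 0})
    (hx : f x = 0) (hu : fderiv ℝ f x u < 0) {r : ℝ} (hr : 0 < r) :
    ∃ s, 0 < s ∧ s < r ∧ x + s • u ∈ Ω := by
  have h1 := ((hf x).hasFDerivAt.hasLineDerivAt u).tendsto_slope_zero_right
  have h2 := h1.eventually_lt_const hu
  obtain ⟨s, hs, hs0, hsr⟩ := (h2.and (Ioo_mem_nhdsGT hr)).exists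
  refine ⟨s, hs0, hsr, ?_⟩
  rw [hx, sub_zero, smul_eq_mul] at hs
  rw [hΩf]
  exact neg_of_mul_neg_right hs (inv_pos.2 hs0).le

theorem fderiv_sub_nonpos (hconv : Convex ℝ Ω) (hopen : IsOpen Ω) (hf : Differentiable ℝ f)
    (hΩf : Ω = {x | f x < 0}) (hfr : frontier Ω = {x | f x = 0}) {y z : F}
    (hy : y ∈ frontier Ω) (hz : z ∈ closure Ω) : fderiv ℝ f y (z - y) ≤ 0 := by
  have hfy : f y = 0 := by rw [hfr] at hy; exact hy
  have hmem : Ω ⊆ {z | fderiv ℝ f y (z - y) ≤ 0} := by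
    intro z hz
    have h1 := ((hf y).hasFDerivAt.hasLineDerivAt (z - y)).tendsto_slope_zero_right
    refine le_of_tendsto h1 ?_
    filter_upwards [Ioo_mem_nhdsGT one_pos] with t ht
    have hmem : y + t • (z - y) ∈ interior Ω :=
      hconv.openSegment_closure_interior_subset_interior (frontier_subset_closure hy)
        (by rwa [hopen.interior_eq]) (openSegment_eq_image' ℝ y z ▸ mem_image_of_mem _ ht)
    rw [hopen.interior_eq, hΩf] at hmem
    have hmem : f (y + t • (z - y)) < 0 := hmem
    rw [hfy, sub_zero, smul_eq_mul]
    exact mul_nonpos_of_nonneg_of_nonpos (inv_pos.2 ht.1).le hmem.le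
  have hclosed : IsClosed {z | fderiv ℝ f y (z - y) ≤ 0} :=
    isClosed_le ((fderiv ℝ f y).continuous.comp (continuous_id.sub continuous_const))
      continuous_const
  exact closure_minimal hmem hclosed hz

theorem fderiv_sub_neg (hconv : Convex ℝ Ω) (hopen : IsOpen Ω) (hf : Differentiable ℝ f)
    (hΩf : Ω = {x | f x < 0}) (hfr : frontier Ω = {x | f x = 0})
    (hgrad : ∀ x ∈ frontier Ω, fderiv ℝ f x ≠ 0) {y z : F}
    (hy : y ∈ frontier Ω) (hz : z ∈ Ω) : fderiv ℝ f y (z - y) < 0 := by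
  refine lt_of_le_of_ne (fderiv_sub_nonpos hconv hopen hf hΩf hfr hy (subset_closure hz))
    fun h0 => hgrad y hy ?_
  ext d
  have key : ∀ d, fderiv ℝ f y d ≤ 0 := by
    intro d
    have hcont : Tendsto (fun ε : ℝ => z + ε • d) (𝓝[>] 0) (𝓝 z) := by
      have : Continuous fun ε : ℝ => z + ε • d := by fun_prop
      exact tendsto_nhdsWithin_of_tendsto_nhds (by simpa using this.tendsto 0)
    obtain ⟨ε, hε, hε0⟩ :=
      ((hcont.eventually (hopen.mem_nhds hz)).and self_mem_nhdsWithin).exists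
    have h1 := fderiv_sub_nonpos hconv hopen hf hΩf hfr hy (subset_closure hε)
    rw [show z + ε • d - y = (z - y) + ε • d by abel, map_add, h0, zero_add, map_smul,
      smul_eq_mul] at h1
    exact nonpos_of_mul_nonpos_right h1 hε0
  have h1 := key d
  have h2 := key (-d)
  rw [map_neg] at h2
  simpa using le_antisymm h1 (by linarith)

theorem exists_unique_pos_ray_frontier (hconv : Convex ℝ Ω) (hopen : IsOpen Ω)
    (hbdd : Bornology.IsBounded Ω) (hf : Differentiable ℝ f)
    (hΩf : Ω = {x | f x < 0}) (hfr : frontier Ω = {x | f x = 0}) {x u : F}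
    (hx : x ∈ frontier Ω) (hu : fderiv ℝ f x u < 0) :
    ∃ r : ℝ, 0 < r ∧ ∀ t : ℝ, 0 < t → (f (x + t • u) = 0 ↔ t = r) := by
  have hfx : f x = 0 := by rw [hfr] at hx; exact hx
  have hu0 : 0 < ‖u‖ := norm_pos_iff.2 (by rintro rfl; simp at hu)
  obtain ⟨s, hs0, -, hs⟩ := exists_pos_lt_add_smul_mem hf hΩf hfx hu one_pos
  obtain ⟨R, hR⟩ := hbdd.subset_closedBall x
  obtain ⟨T, hT0, hT⟩ : ∃ T : ℝ, 0 < T ∧ x + T • u ∉ Ω := by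
    refine ⟨(|R| + 1) / ‖u‖, by positivity, fun h => ?_⟩
    have := hR h
    rw [mem_closedBall_iff_norm, add_sub_cancel_left, norm_smul, Real.norm_eq_abs,
      abs_of_pos (by positivity), div_mul_cancel₀ _ hu0.ne'] at this
    linarith [le_abs_self R]
  have hcont : Continuous fun t : ℝ => f (x + t • u) :=
    hf.continuous.comp (by fun_prop)
  have hneg : f (x + s • u) < 0 := by rw [hΩf] at hs; exact hs
  have hpos : 0 ≤ f (x + T • u) := by
    rw [hΩf] at hT; exact not_lt.1 hT
  obtain ⟨r, hr, hfr0⟩ := intermediate_value_uIcc (a := s) (b := T) hcont.continuousOn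
    (show (0 : ℝ) ∈ uIcc _ _ from mem_uIcc.2 (Or.inl ⟨hneg.le, hpos⟩))
  have hr0 : 0 < r := (lt_min hs0 hT0).trans_le hr.1
  have aux : ∀ a b : ℝ, 0 < a → a < b → f (x + a • u) = 0 → f (x + b • u) = 0 → False := by
    intro a b ha hab hfa hfb
    obtain ⟨c, hc0, hca, hc⟩ := exists_pos_lt_add_smul_mem hf hΩf hfx hu ha
    have hb : x + b • u ∈ closure Ω := frontier_subset_closure (by rw [hfr]; exact hfb)
    have hcb : 0 < b - c := by linarith
    have hmem : x + a • u ∈ interior Ω := by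
      refine hconv.openSegment_interior_closure_subset_interior
        (by rwa [hopen.interior_eq]) hb ?_
      rw [openSegment_eq_image']
      refine ⟨(a - c) / (b - c), ⟨by apply div_pos <;> linarith,
        by rw [div_lt_one hcb]; linarith⟩, ?_⟩
      simp only
      rw [add_sub_add_left_eq_sub, ← sub_smul, smul_smul, div_mul_cancel₀ _ hcb.ne', add_assoc,
        ← add_smul, add_sub_cancel]
    rw [hopen.interior_eq, hΩf] at hmem
    exact absurd hfa (ne_of_lt hmem)
  refine ⟨r, hr0, fun t ht => ⟨fun h => ?_, by rintro rfl; exact hfr0⟩⟩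
  rcases lt_trichotomy t r with h' | h' | h'
  · exact (aux t r ht h' h hfr0).elim
  · exact h'
  · exact (aux r t hr0 h' hfr0 h).elim

theorem fderiv_pos_of_ray_frontier (hconv : Convex ℝ Ω) (hopen : IsOpen Ω)
    (hf : Differentiable ℝ f) (hΩf : Ω = {x | f x < 0}) (hfr : frontier Ω = {x | f x = 0})
    (hgrad : ∀ x ∈ frontier Ω, fderiv ℝ f x ≠ 0) {x u : F} (hx : f x = 0)
    (hu : fderiv ℝ f x u < 0) {r : ℝ} (hr : 0 < r) (hxr : f (x + r • u) = 0) :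
    0 < fderiv ℝ f (x + r • u) u := by
  obtain ⟨s, hs0, hsr, hs⟩ := exists_pos_lt_add_smul_mem hf hΩf hx hu hr
  have h1 := fderiv_sub_neg hconv hopen hf hΩf hfr hgrad (y := x + r • u)
    (by rw [hfr]; exact hxr) hs
  rw [add_sub_add_left_eq_sub, ← sub_smul, map_smul, smul_eq_mul] at h1
  exact pos_of_mul_neg_right h1 (by linarith)

end ConvexSublevel

theorem contDiff_one_of_implicit {E : Type*} [NormedAddCommGroup E] [NormedSpace ℝ E]
    [CompleteSpace E] {G : E × ℝ → ℝ} {r : E → ℝ} (hG : ContDiff ℝ 1 G) (hr : ∀ v, 0 < r v)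
    (hzero : ∀ v t, 0 < t → (G (v, t) = 0 ↔ t = r v))
    (hderiv : ∀ v, fderiv ℝ G (v, r v) (0, 1) ≠ 0) : ContDiff ℝ 1 r := by
  rw [contDiff_iff_contDiffAt]
  intro v
  have hGv : ContDiffAt ℝ 1 G (v, r v) := hG.contDiffAt
  set d := fderiv ℝ G (v, r v) (0, 1)
  have hinv : (fderiv ℝ G (v, r v) ∘L .inr ℝ E ℝ).IsInvertible := by
    refine ⟨ContinuousLinearEquiv.unitsEquivAut ℝ (Units.mk0 d (hderiv v)), ?_⟩
    ext
    simp [d]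
  have h0 : G (v, r v) = 0 := (hzero v _ (hr v)).2 rfl
  have hψ := hGv.contDiffAt_implicitFunction one_ne_zero hinv
  have hψv : hGv.implicitFunction one_ne_zero hinv v = r v :=
    hGv.implicitFunction_apply_self one_ne_zero hinv
  have hpos : ∀ᶠ w in 𝓝 v, 0 < hGv.implicitFunction one_ne_zero hinv w :=
    hψ.continuousAt.eventually_const_lt (by rw [hψv]; exact hr v)
  refine hψ.congr_of_eventuallyEq ?_
  filter_upwards [hpos, hGv.eventually_apply_implicitFunction one_ne_zero hinv] with w hw hw'
  exact ((hzero w _ hw).1 (hw'.trans h0)).symm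

section ConvexFrontier

variable {F : Type*} [NormedAddCommGroup F] [InnerProductSpace ℝ F] [FiniteDimensional ℝ F]
  [MeasurableSpace F] [BorelSpace F] {Ω : Set F} {f : F → ℝ} {ν : F → F} {m : ℕ}

theorem setIntegral_frontier_interaction (hdim : finrank ℝ F = m + 1) (hconv : Convex ℝ Ω)
    (hopen : IsOpen Ω) (hbdd : Bornology.IsBounded Ω) (hf : ContDiff ℝ 1 f)
    (hΩf : Ω = {x | f x < 0}) (hfr : frontier Ω = {x | f x = 0})
    (hν : ∀ y ∈ frontier Ω, ‖ν y‖ = 1)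
    (hνf : ∀ y ∈ frontier Ω, ∃ k : ℝ, 0 < k ∧ ∀ z, fderiv ℝ f y z = k * ⟪ν y, z⟫)
    {x : F} (hx : x ∈ frontier Ω) :
    ∫ y in frontier Ω, |⟪ν x, y - x⟫ * ⟪y - x, ν y⟫| / ‖x - y‖ ^ (m + 2) ∂μH[m] =
      1 / 2 * ∫ w in Metric.sphere (0 : F) 1, |⟪ν x, w⟫| ∂μH[m] := by
  have hfd : Differentiable ℝ f := hf.differentiable one_ne_zero
  have hmem : ∀ {y}, y ∈ frontier Ω ↔ f y = 0 := by rw [hfr]; rfl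
  have hgrad : ∀ y ∈ frontier Ω, fderiv ℝ f y ≠ 0 := by
    intro y hy h0
    obtain ⟨k, hk, hk'⟩ := hνf y hy
    have := hk' (ν y)
    rw [h0, real_inner_self_eq_norm_sq, hν y hy] at this
    exact hk.ne (by simpa using this)
  set N := ν x
  have hN : ‖N‖ = 1 := hν x hx
  have hN0 : N ≠ 0 := norm_pos_iff.1 (hN ▸ one_pos)
  set ι : (ℝ ∙ N)ᗮ →ₗᵢ[ℝ] F := (ℝ ∙ N)ᗮ.subtypeₗᵢ
  have : Fact (finrank ℝ F = m + 1) := ⟨hdim⟩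
  have hm : finrank ℝ (ℝ ∙ N)ᗮ = m := Submodule.finrank_orthogonal_span_singleton hN0
  have hdim' : finrank ℝ F = finrank ℝ (ℝ ∙ N)ᗮ + 1 := by rw [hm, hdim]
  have hιN : ∀ h, ⟪N, ι h⟫ = 0 := fun h => Submodule.mem_orthogonal_singleton_iff_inner_right.1 h.2
  have hι : ∀ z, ⟪N, z⟫ = 0 → ∃ b, ι b = z := fun z hz =>
    ⟨⟨z, Submodule.mem_orthogonal_singleton_iff_inner_right.2 hz⟩, rfl⟩
  obtain ⟨k, hk, hkN⟩ := hνf x hx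
  have hu : ∀ v, fderiv ℝ f x (ι v - N) < 0 := fun v => by
    rw [hkN, inner_sub_normal hN hιN]; linarith
  choose r hr0 hr using fun v =>
    exists_unique_pos_ray_frontier hconv hopen hbdd hfd hΩf hfr hx (hu v)
  have hfΦ : ∀ v, f (x + r v • (ι v - N)) = 0 := fun v => (hr v _ (hr0 v)).2 rfl
  have hr1 : ContDiff ℝ 1 r := by
    have hG' : ContDiff ℝ 1 fun p : (ℝ ∙ N)ᗮ × ℝ => x + p.2 • (ι p.1 - N) :=
      contDiff_const.add (contDiff_snd.smul
        ((ι.toContinuousLinearMap.contDiff.comp contDiff_fst).sub contDiff_const))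
    refine contDiff_one_of_implicit (hf.comp hG') hr0 hr fun v => ?_
    have h1 : HasFDerivAt (f ∘ fun p : (ℝ ∙ N)ᗮ × ℝ => x + p.2 • (ι p.1 - N)) _ (v, r v) :=
      (((hf.comp hG').differentiable one_ne_zero) _).hasFDerivAt
    have h2 : HasDerivAt (fun t : ℝ => ((v, t) : (ℝ ∙ N)ᗮ × ℝ)) (0, 1) (r v) :=
      (hasDerivAt_const _ _).prodMk (hasDerivAt_id _)
    have h3 := h1.comp_hasDerivAt (r v) h2
    have h4 : HasDerivAt (fun t : ℝ => x + t • (ι v - N)) (ι v - N) (r v) := by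
      simpa using ((hasDerivAt_id (r v)).smul_const (ι v - N)).const_add x
    have h5 := (hfd (x + r v • (ι v - N))).hasFDerivAt.comp_hasDerivAt (r v) h4
    rw [h3.unique h5]
    exact (fderiv_pos_of_ray_frontier hconv hopen hfd hΩf hfr hgrad (hmem.1 hx) (hu v) (hr0 v)
      (hfΦ v)).ne'
  have hΦ : ContDiff ℝ 1 fun v => x + r v • (ι v - N) :=
    contDiff_const.add (hr1.smul (ι.toContinuousLinearMap.contDiff.sub contDiff_const))
  have htan : ∀ v h, ⟪ν (x + r v • (ι v - N)),
      fderiv ℝ (fun v => x + r v • (ι v - N)) v h⟫ = 0 := by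
    intro v h
    obtain ⟨k, hk, hk'⟩ := hνf _ (hmem.2 (hfΦ v))
    have h1 := (hfd (x + r v • (ι v - N))).hasFDerivAt.comp v
      (hΦ.differentiable one_ne_zero v).hasFDerivAt
    have h2 := h1.unique ((hasFDerivAt_const (0 : ℝ) v).congr_of_eventuallyEq
      (Eventually.of_forall hfΦ))
    have h3 := DFunLike.congr_fun h2 h
    rw [ContinuousLinearMap.comp_apply, hk'] at h3
    exact (mul_eq_zero.1 h3).resolve_left hk.ne'
  have hrange : range (fun v => x + r v • (ι v - N)) = frontier Ω ∩ {y | ⟪N, y - x⟫ < 0} := by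
    ext y
    constructor
    · rintro ⟨v, rfl⟩
      refine ⟨hmem.2 (hfΦ v), ?_⟩
      rw [mem_ofPred_eq, add_sub_cancel_left, inner_smul_right, inner_sub_normal hN hιN]
      linarith [hr0 v]
    · rintro ⟨hy, hNy⟩
      obtain ⟨v, t, ht, hty⟩ := exists_smul_sub_normal_eq hι hN hNy
      have hyt : y = x + t • (ι v - N) := by rw [hty, add_sub_cancel]
      refine ⟨v, ?_⟩
      rw [hyt, (hr v t ht).1 (by rw [← hyt]; exact hmem.1 hy)]
  have hgraph := setIntegral_interaction_radialGraph hdim' hN hιN hr1 hr0 x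
    (fun v => hν _ (hmem.2 (hfΦ v))) htan
  rw [hrange, ← setIntegral_abs_inner_halfSphere hdim' hN hιN hι, hm] at hgraph
  rw [setIntegral_abs_inner_sphere, ← hgraph, one_div, inv_mul_cancel_left₀ two_ne_zero]
  refine setIntegral_eq_of_subset_of_forall_sdiff_eq_zero isClosed_frontier.measurableSet
    inter_subset_left ?_
  rintro y ⟨hy, hy'⟩
  have h0 : ⟪N, y - x⟫ = 0 := by
    refine le_antisymm ?_ (not_lt.1 fun h => hy' ⟨hy, h⟩)
    have := fderiv_sub_nonpos hconv hopen hfd hΩf hfr hx (frontier_subset_closure hy)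
    rw [hkN] at this
    exact nonpos_of_mul_nonpos_right this hk
  rw [h0, zero_mul, abs_zero, zero_div]

end ConvexFrontier

end

/-- For a bounded open *convex* set `Ω ⊆ ℝⁿ` (n ≥ 2) with `C¹` boundary
and outward unit normal `ν`, the bilinear boundary interaction energy equals
`c_n · σ(∂Ω)` where `c_n = (1/2) ∫_{S^{n-1}} |w₁| dσ(w)`. -/
theorem statement1 (n : ℕ) (hn : 2 ≤ n)
    (Ω : Set (EuclideanSpace ℝ (Fin n)))
    (hΩopen : IsOpen Ω) (hΩbdd : Bornology.IsBounded Ω) (hΩconv : Convex ℝ Ω)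
    (f : EuclideanSpace ℝ (Fin n) → ℝ) (hf : ContDiff ℝ 1 f)
    (hΩf : Ω = {x | f x < 0})
    (hfr : frontier Ω = {x | f x = 0})
    (hgrad : ∀ x ∈ frontier Ω, gradient f x ≠ 0)
    (ν : EuclideanSpace ℝ (Fin n) → EuclideanSpace ℝ (Fin n))
    (hν : ∀ x ∈ frontier Ω, ν x = ‖gradient f x‖⁻¹ • gradient f x) :
    (∫ x in frontier Ω, ∫ y in frontier Ω,
        |⟪ν x, y - x⟫ * ⟪y - x, ν y⟫| / ‖x - y‖ ^ (n + 1)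
          ∂(μH[(n : ℝ) - 1]) ∂(μH[(n : ℝ) - 1]))
      = ((1 : ℝ) / 2 *
          ∫ w in Metric.sphere (0 : EuclideanSpace ℝ (Fin n)) 1,
            |w ⟨0, by omega⟩| ∂(μH[(n : ℝ) - 1]))
        * (μH[(n : ℝ) - 1] (frontier Ω)).toReal := by
  obtain ⟨m, rfl⟩ : ∃ m, n = m + 1 := ⟨n - 1, by omega⟩
  have hd : ((m + 1 : ℕ) : ℝ) - 1 = m := by push_cast; ring
  rw [hd]
  have hν1 : ∀ y ∈ frontier Ω, ‖ν y‖ = 1 := fun y hy => by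
    rw [hν y hy, norm_smul, norm_inv, norm_norm, inv_mul_cancel₀ (norm_ne_zero_iff.2 (hgrad y hy))]
  have hνf : ∀ y ∈ frontier Ω, ∃ k : ℝ, 0 < k ∧ ∀ z, fderiv ℝ f y z = k * ⟪ν y, z⟫ :=
    fun y hy => ⟨‖gradient f y‖, norm_pos_iff.2 (hgrad y hy), fun z => by
      rw [hν y hy, real_inner_smul_left, inner_gradient_left,
        mul_inv_cancel_left₀ (norm_ne_zero_iff.2 (hgrad y hy))]⟩
  have hinner : ∀ x ∈ frontier Ω,
      ∫ y in frontier Ω, |⟪ν x, y - x⟫ * ⟪y - x, ν y⟫| / ‖x - y‖ ^ (m + 1 + 1) ∂μH[m] =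
        1 / 2 * ∫ w in Metric.sphere (0 : EuclideanSpace ℝ (Fin (m + 1))) 1,
          |w ⟨0, by omega⟩| ∂μH[m] := by
    intro x hx
    rw [setIntegral_frontier_interaction finrank_euclideanSpace_fin hΩconv hΩopen hΩbdd hf hΩf hfr
      hν1 hνf hx, setIntegral_abs_inner_sphere_eq_of_norm_eq (N' := EuclideanSpace.single 0 1) _
      (by rw [hν1 x hx]; simp)]
    congr 2 with w
    rw [EuclideanSpace.inner_single_left, map_one, one_mul]
    rfl
  rw [setIntegral_congr_fun isClosed_frontier.measurableSet hinner, setIntegral_const, smul_eq_mul,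
    mul_comm]
  rfl
end

section
/- Let n ≥ 2 and let Ω ⊂ ℝⁿ be a bounded open convex set with C¹ boundary, with outward unit normal ν. Then for every point x ∈ Ω (an interior point, i.e. x not in the frontier) and every unit vector w ∈ ℝⁿ, ∫_{∂Ω} |⟨w, y − x⟩ · ⟨y − x, ν(y)⟩| / ‖x − y‖^{n+1} dσ(y) = 2 · c_n, where c_n = (1/2) ∫_{S^{n−1}} |u₁| dσ(u). -/
open MeasureTheory RealInnerProductSpace
open Module (finrank)
open Set Filter Topology
open scoped ENNReal NNReal

section Metric

/-- If two maps `g`, `h` on `A` satisfy `dist (g y) (g y') ≤ K * dist (h y) (h y')`, then the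
Hausdorff measures of their images compare accordingly. -/
theorem hausdorffMeasure_image_le_of_dist_le {X Y Z : Type*}
    [MetricSpace Y] [MeasurableSpace Y] [BorelSpace Y]
    [MetricSpace Z] [MeasurableSpace Z] [BorelSpace Z]
    {A : Set X} {g : X → Y} {h : X → Z} {K : ℝ≥0} (d : ℕ)
    (H : ∀ y ∈ A, ∀ y' ∈ A, dist (g y) (g y') ≤ K * dist (h y) (h y')) :
    μH[(d : ℝ)] (g '' A) ≤ (K : ℝ≥0∞) ^ d * μH[(d : ℝ)] (h '' A) := by
  rcases A.eq_empty_or_nonempty with rfl | ⟨a, -⟩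
  · simp
  have : Nonempty X := ⟨a⟩
  set φ : Z → Y := fun z => g (Function.invFunOn h A z) with hφ
  have hinv : ∀ z ∈ h '' A, Function.invFunOn h A z ∈ A ∧ h (Function.invFunOn h A z) = z :=
    fun z hz => ⟨Function.invFunOn_mem hz, Function.invFunOn_eq hz⟩
  have hL : LipschitzOnWith K φ (h '' A) := by
    refine LipschitzOnWith.of_dist_le_mul fun z hz z' hz' => ?_
    have := H _ (hinv z hz).1 _ (hinv z' hz').1
    rwa [(hinv z hz).2, (hinv z' hz').2] at this
  have himg : φ '' (h '' A) = g '' A := by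
    rw [image_image]
    refine image_congr fun y hy => ?_
    have hz := hinv (h y) (mem_image_of_mem h hy)
    have := H _ hz.1 _ hy
    rw [hz.2, dist_self, mul_zero] at this
    exact dist_le_zero.1 this
  have := hL.hausdorffMeasure_image_le (d := (d : ℝ)) (Nat.cast_nonneg d)
  rwa [himg, ENNReal.rpow_natCast] at this

/-- A domination between two measures can be checked locally. -/
theorem measure_le_smul_of_locally_s4 {X : Type*} [TopologicalSpace X] [SecondCountableTopology X]
    [MeasurableSpace X] [BorelSpace X] (μ ν : Measure X) (c : ℝ≥0∞)
    (H : ∀ x, ∃ U ∈ 𝓝 x, ∀ A ⊆ U, MeasurableSet A → μ A ≤ c * ν A) :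
    μ ≤ c • ν := by
  choose U hU hUA using H
  obtain ⟨s, hsc, hs⟩ := TopologicalSpace.countable_cover_nhds fun x => interior_mem_nhds.2 (hU x)
  refine Measure.le_iff.2 fun A hA => ?_
  rcases isEmpty_or_nonempty X with hX | ⟨⟨x₀⟩⟩
  · simp [Set.eq_empty_of_isEmpty A]
  have hsn : s.Nonempty := by
    by_contra hne
    rw [not_nonempty_iff_eq_empty] at hne
    have : x₀ ∈ (⋃ x ∈ s, interior (U x)) := by rw [hs]; trivial
    simp [hne] at this
  obtain ⟨e, rfl⟩ := hsc.exists_eq_range hsn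
  set V : ℕ → Set X := fun i => interior (U (e i)) with hV
  have hcov : ⋃ i, disjointed V i = univ := by
    rw [iUnion_disjointed, ← hs, biUnion_range]
  have hVm : ∀ i, MeasurableSet (disjointed V i) :=
    fun i => MeasurableSet.disjointed (fun j => isOpen_interior.measurableSet) i
  have hAeq : A = ⋃ i, A ∩ disjointed V i := by rw [← inter_iUnion, hcov, inter_univ]
  have hdisj : Pairwise (Function.onFun Disjoint fun i => A ∩ disjointed V i) :=
    fun i j hij => (disjoint_disjointed V hij).mono inter_subset_right inter_subset_right
  rw [Measure.smul_apply, smul_eq_mul]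
  conv_lhs => rw [hAeq]
  conv_rhs => rw [hAeq]
  rw [measure_iUnion hdisj fun i => hA.inter (hVm i),
    measure_iUnion hdisj fun i => hA.inter (hVm i), ← ENNReal.tsum_mul_left]
  exact ENNReal.tsum_le_tsum fun i => hUA (e i) _
    (inter_subset_right.trans ((disjointed_subset V i).trans interior_subset))
    (hA.inter (hVm i))

end Metric

section Radial

variable {E : Type*} [NormedAddCommGroup E] [InnerProductSpace ℝ E]

/-- The derivative of the radial projection `z ↦ z / ‖z‖` at a nonzero point. -/
theorem hasStrictFDerivAt_inv_norm_smul {z : E} (hz : z ≠ 0) :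
    HasStrictFDerivAt (fun y : E => ‖y‖⁻¹ • y)
      (‖z‖⁻¹ • (ContinuousLinearMap.id ℝ E -
        (innerSL ℝ (‖z‖⁻¹ • z)).smulRight (‖z‖⁻¹ • z))) z := by
  have hz' : ‖z‖ ≠ 0 := norm_ne_zero_iff.2 hz
  have h1 := (hasStrictFDerivAt_norm_sq z).sqrt (by positivity)
  simp only [Real.sqrt_sq (norm_nonneg _)] at h1
  have h2 := ((hasStrictDerivAt_inv hz').comp_hasStrictFDerivAt z h1).smul (hasStrictFDerivAt_id z)
  refine h2.congr_fderiv ?_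
  ext v
  have hl : ((Inv.inv ∘ norm) z • ContinuousLinearMap.id ℝ E +
      (-(‖z‖ ^ 2)⁻¹ • (1 / (2 * ‖z‖)) • 2 • (innerSL ℝ) z).smulRight (id z)) v =
      ‖z‖⁻¹ • v + (-(‖z‖ ^ 2)⁻¹ * (1 / (2 * ‖z‖) * (2 * ⟪z, v⟫))) • z := by
    simp [smul_smul, mul_assoc]
  have hr : (‖z‖⁻¹ • (ContinuousLinearMap.id ℝ E -
        (innerSL ℝ (‖z‖⁻¹ • z)).smulRight (‖z‖⁻¹ • z))) v =
      ‖z‖⁻¹ • (v - (‖z‖⁻¹ * ⟪z, v⟫) • ‖z‖⁻¹ • z) := by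
    simp [smul_smul]
  rw [hl, hr, smul_sub, smul_smul, smul_smul, sub_eq_add_neg, ← neg_smul]
  congr 2
  field_simp

variable [FiniteDimensional ℝ E]

/-- The Jacobian of the derivative of the radial projection, restricted to a hyperplane. -/
theorem normDet_radial_hyperplane {d : ℕ} (hd : finrank ℝ E = d + 1) {u e : E} (hu : ‖u‖ = 1)
    (he : ‖e‖ = 1) {r : ℝ} (hr : 0 < r) :
    LinearMap.normDet (((r⁻¹ • (ContinuousLinearMap.id ℝ E - (innerSL ℝ u).smulRight u) :
      E →L[ℝ] E) : E →ₗ[ℝ] E) ∘ₗ (ℝ ∙ e)ᗮ.subtype) = |⟪u, e⟫| / r ^ d := by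
  have : Fact (finrank ℝ E = d + 1) := ⟨hd⟩
  have he0 : e ≠ 0 := by rintro rfl; simp at he
  have hfin : finrank ℝ (ℝ ∙ e)ᗮ = d := Submodule.finrank_orthogonal_span_singleton he0
  set T := (ℝ ∙ e)ᗮ with hT
  set L : T →ₗ[ℝ] E := ((ContinuousLinearMap.id ℝ E - (innerSL ℝ u).smulRight u :
      E →L[ℝ] E) : E →ₗ[ℝ] E) ∘ₗ T.subtype with hL
  have hLs : (((r⁻¹ • (ContinuousLinearMap.id ℝ E - (innerSL ℝ u).smulRight u) :
      E →L[ℝ] E) : E →ₗ[ℝ] E) ∘ₗ T.subtype) = r⁻¹ • L := by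
    ext v; simp [hL]
  rw [hLs, LinearMap.normDet_smul, hfin]
  have hLa : ∀ v : T, L v = (v : E) - ⟪u, (v : E)⟫ • u := fun v => by simp [hL]
  set p : T := T.orthogonalProjectionOnto u with hp
  have hpi : ∀ v : T, ⟪p, v⟫ = ⟪u, (v : E)⟫ := fun v => by
    simp [hp]
  have hadj : L.adjoint ∘ₗ L = LinearMap.transvection (innerSL ℝ p : T →ₗ[ℝ] ℝ) (-p) := by
    ext1 v
    refine ext_inner_right ℝ fun w => ?_
    rw [LinearMap.comp_apply, LinearMap.adjoint_inner_left, hLa, hLa, LinearMap.transvection.apply]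
    simp only [inner_sub_left, inner_sub_right, inner_add_left, real_inner_smul_left,
      real_inner_smul_right, smul_neg, inner_neg_left, real_inner_self_eq_norm_sq, hu,
      ContinuousLinearMap.coe_coe, innerSL_apply_apply, hpi, ← Submodule.coe_inner]
    rw [Submodule.coe_inner]
    rw [real_inner_comm (v : E) u]
    ring
  have hsq : L.normDet ^ 2 = ⟪u, e⟫ ^ 2 := by
    have h := L.normDet_sq
    rw [hadj, LinearMap.transvection.det] at h
    have h' : L.normDet ^ 2 = 1 - ‖p‖ ^ 2 := by
      simpa [sub_eq_add_neg] using h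
    have hdec := Submodule.norm_sq_eq_add_norm_sq_projection u (ℝ ∙ e)
    have hpe : ‖(ℝ ∙ e).orthogonalProjectionOnto u‖ ^ 2 = ⟪u, e⟫ ^ 2 := by
      rw [← Submodule.norm_coe, ← Submodule.starProjection_apply,
        Submodule.starProjection_unit_singleton ℝ he, norm_smul, he,
        mul_one, Real.norm_eq_abs, sq_abs, real_inner_comm]
    rw [hu, hpe] at hdec
    rw [h']
    linarith
  have habs : L.normDet = |⟪u, e⟫| := by
    rw [← abs_of_nonneg L.normDet_nonneg]
    exact (sq_eq_sq_iff_abs_eq_abs _ _).1 hsq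
  rw [habs, Real.norm_eq_abs, abs_of_pos (inv_pos.2 hr), inv_pow]
  field_simp

end Radial

section Local

variable {E : Type*} [NormedAddCommGroup E] [InnerProductSpace ℝ E] [FiniteDimensional ℝ E]

/-- Near a regular point of a level set `F`, both the projection to the tangent space and a map `P`
whose derivative is injective on the tangent space are almost equivalent to linear models. -/
theorem exists_nhds_almost_isometric {G : Type*} [NormedAddCommGroup G] [NormedSpace ℝ G]
    {F : Set E} {y₀ e : E} {f : E → ℝ} (he : ‖e‖ = 1) (hf : HasStrictFDerivAt f (innerSL ℝ e) y₀)
    (hF : ∀ y ∈ F, f y = 0) {P : E → G} {D : E →L[ℝ] G} (hP : HasStrictFDerivAt P D y₀)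
    (hker : ((D : E →ₗ[ℝ] G) ∘ₗ (ℝ ∙ e)ᗮ.subtype).ker = ⊥) {K : ℝ} (hK : 1 < K) :
    ∃ U ∈ 𝓝 y₀, ∀ y ∈ U ∩ F, ∀ y' ∈ U ∩ F,
      ‖y - y'‖ ≤ K * ‖(ℝ ∙ e)ᗮ.orthogonalProjectionOnto (y - y')‖ ∧
      ‖P y - P y'‖ ≤ K * ‖D ((ℝ ∙ e)ᗮ.orthogonalProjectionOnto (y - y') : E)‖ ∧
      ‖D ((ℝ ∙ e)ᗮ.orthogonalProjectionOnto (y - y') : E)‖ ≤ K * ‖P y - P y'‖ := by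
  obtain ⟨c, hc, hanti⟩ := LinearMap.exists_antilipschitzWith _ hker
  have hanti' : ∀ τ : (ℝ ∙ e)ᗮ, ‖τ‖ ≤ c * ‖D (τ : E)‖ := fun τ => by
    simpa using hanti.le_mul_dist τ 0
  have hc' : (0 : ℝ) < c := by exact_mod_cast hc
  set M : ℝ := 1 + ‖D‖ with hM
  have hM0 : 0 < M := by positivity
  set η : ℝ := 1 - K⁻¹ with hη
  have hKi : K⁻¹ < 1 := inv_lt_one_of_one_lt₀ hK
  have hKi0 : 0 < K⁻¹ := by positivity
  have hη0 : 0 < η := by linarith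
  set ε : ℝ := min (1 / 2) (min η (η / (2 * M * c))) with hε
  have hε0 : 0 < ε := by positivity
  have hε1 : ε ≤ 1 / 2 := min_le_left _ _
  have hε2 : ε ≤ η := (min_le_right _ _).trans (min_le_left _ _)
  have hε3 : ε ≤ η / (2 * M * c) := (min_le_right _ _).trans (min_le_right _ _)
  have hε3' : 2 * M * c * ε ≤ η := by
    rw [le_div_iff₀ (by positivity)] at hε3; linarith
  have h1 := hf.isLittleO.def hε0
  have h2 := hP.isLittleO.def hε0
  have h12 := h1.and h2
  rw [nhds_prod_eq] at h12
  obtain ⟨U, hU, hUU⟩ := mem_prod_self_iff.1 h12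
  refine ⟨U, hU, fun y hy y' hy' => ?_⟩
  obtain ⟨h3, h4⟩ := hUU (mk_mem_prod hy.1 hy'.1)
  simp only [hF y hy.2, hF y' hy'.2, sub_self, zero_sub, norm_neg, innerSL_apply_apply] at h3
  simp only at h4
  set Δ := y - y' with hΔ
  set τ := (ℝ ∙ e)ᗮ.orthogonalProjectionOnto Δ with hτ
  have hdec : Δ - (τ : E) = ⟪e, Δ⟫ • e := by
    have := Submodule.starProjection_add_starProjection_orthogonal (K := ℝ ∙ e) Δ
    rw [Submodule.starProjection_unit_singleton ℝ he] at this
    rw [hτ, ← Submodule.starProjection_apply, sub_eq_iff_eq_add, this]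
  have hdecn : ‖Δ - (τ : E)‖ ≤ ε * ‖Δ‖ := by
    rw [hdec, norm_smul, he, mul_one]; exact h3
  have hΔτ : ‖Δ‖ ≤ ‖τ‖ + ε * ‖Δ‖ := by
    have := norm_add_le (Δ - (τ : E)) (τ : E)
    rw [sub_add_cancel] at this
    rw [← Submodule.norm_coe]
    linarith
  have hΔ0 := norm_nonneg Δ
  have hΔτ2 : ‖Δ‖ ≤ 2 * ‖τ‖ := by nlinarith
  have hK1 : K * (1 - η) = 1 := by
    rw [hη]; field_simp; ring
  have hdiff : ‖P y - P y' - D (τ : E)‖ ≤ η * ‖D (τ : E)‖ := by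
    have e1 : P y - P y' - D (τ : E) = (P y - P y' - D Δ) + D (Δ - (τ : E)) := by
      rw [map_sub D Δ]; abel
    calc ‖P y - P y' - D (τ : E)‖ ≤ ε * ‖Δ‖ + ‖D‖ * (ε * ‖Δ‖) := by
          rw [e1]
          refine (norm_add_le _ _).trans (add_le_add h4 ?_)
          exact (D.le_opNorm _).trans (by gcongr)
      _ = ε * M * ‖Δ‖ := by rw [hM]; ring
      _ ≤ ε * M * (2 * (c * ‖D (τ : E)‖)) := by
          gcongr
          exact hΔτ2.trans (by gcongr; exact hanti' τ)
      _ = (2 * M * c * ε) * ‖D (τ : E)‖ := by ring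
      _ ≤ η * ‖D (τ : E)‖ := by gcongr
  have hD0 := norm_nonneg (D (τ : E))
  have hP0 := norm_nonneg (P y - P y')
  refine ⟨?_, ?_, ?_⟩
  · have : (1 - η) * ‖Δ‖ ≤ ‖τ‖ := by nlinarith
    calc ‖Δ‖ = K * ((1 - η) * ‖Δ‖) := by rw [← mul_assoc, hK1, one_mul]
      _ ≤ K * ‖τ‖ := by gcongr
  · have h5 : ‖P y - P y'‖ ≤ (1 + η) * ‖D (τ : E)‖ := by
      have := norm_add_le (P y - P y' - D (τ : E)) (D (τ : E))
      rw [sub_add_cancel] at this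
      linarith
    have h6 : 1 + η ≤ K := by nlinarith
    exact h5.trans (by gcongr)
  · have h5 : (1 - η) * ‖D (τ : E)‖ ≤ ‖P y - P y'‖ := by
      have := norm_sub_le (P y - P y') (P y - P y' - D (τ : E))
      rw [sub_sub_cancel] at this
      linarith
    calc ‖D (τ : E)‖ = K * ((1 - η) * ‖D (τ : E)‖) := by rw [← mul_assoc, hK1, one_mul]
      _ ≤ K * ‖P y - P y'‖ := by gcongr

variable [MeasurableSpace E] [BorelSpace E]

/-- Local comparison of the Hausdorff measure on a regular level set with the Hausdorff measure of
its radial projection from `x`. -/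
theorem exists_nhds_hausdorffMeasure_radial {d : ℕ} (hd : finrank ℝ E = d + 1)
    {F : Set E} {x y₀ g : E} {f : E → ℝ} (hg : g ≠ 0) (hf : HasStrictFDerivAt f (innerSL ℝ g) y₀)
    (hF : ∀ y ∈ F, f y = 0) (hin : ⟪y₀ - x, g⟫ ≠ 0) {K : ℝ≥0} (hK : 1 < K) :
    ∃ U ∈ 𝓝 y₀, ∀ A ⊆ U ∩ F,
      μH[(d : ℝ)] ((fun y => ‖y - x‖⁻¹ • (y - x)) '' A) ≤ (K : ℝ≥0∞) ^ (2 * d) *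
        (ENNReal.ofReal (|⟪‖y₀ - x‖⁻¹ • (y₀ - x), ‖g‖⁻¹ • g⟫| / ‖y₀ - x‖ ^ d) * μH[(d : ℝ)] A) ∧
      ENNReal.ofReal (|⟪‖y₀ - x‖⁻¹ • (y₀ - x), ‖g‖⁻¹ • g⟫| / ‖y₀ - x‖ ^ d) * μH[(d : ℝ)] A ≤
        (K : ℝ≥0∞) ^ (2 * d) * μH[(d : ℝ)] ((fun y => ‖y - x‖⁻¹ • (y - x)) '' A) := by
  have hz : y₀ - x ≠ 0 := fun h => hin (by rw [h, inner_zero_left])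
  have hr : 0 < ‖y₀ - x‖ := norm_pos_iff.2 hz
  have hgn : 0 < ‖g‖ := norm_pos_iff.2 hg
  set e := ‖g‖⁻¹ • g with he'
  set u := ‖y₀ - x‖⁻¹ • (y₀ - x) with hu'
  have he : ‖e‖ = 1 := norm_smul_inv_norm hg
  have hu : ‖u‖ = 1 := norm_smul_inv_norm hz
  have he0 : e ≠ 0 := by rintro h; simp [h] at he
  have : Fact (finrank ℝ E = d + 1) := ⟨hd⟩
  have hfin : finrank ℝ (ℝ ∙ e)ᗮ = d := Submodule.finrank_orthogonal_span_singleton he0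
  have hue : ⟪u, e⟫ ≠ 0 := by
    rw [hu', he', real_inner_smul_left, real_inner_smul_right]
    positivity
  set P : E → E := fun y => ‖y - x‖⁻¹ • (y - x) with hP'
  set D : E →L[ℝ] E := ‖y₀ - x‖⁻¹ • (ContinuousLinearMap.id ℝ E - (innerSL ℝ u).smulRight u)
    with hD
  have hP : HasStrictFDerivAt P D y₀ := by
    have := (hasStrictFDerivAt_inv_norm_smul hz).comp y₀ ((hasStrictFDerivAt_id y₀).sub_const x)
    rwa [ContinuousLinearMap.comp_id] at this
  set L := (D : E →ₗ[ℝ] E) ∘ₗ (ℝ ∙ e)ᗮ.subtype with hL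
  have hdet : L.normDet = |⟪u, e⟫| / ‖y₀ - x‖ ^ d := normDet_radial_hyperplane hd hu he hr
  have hker : L.ker = ⊥ := by
    by_contra h
    have := LinearMap.normDet_eq_zero_iff_ker_ne_bot.2 h
    rw [hdet] at this
    have : 0 < |⟪u, e⟫| / ‖y₀ - x‖ ^ d := by positivity
    linarith
  have hf' : HasStrictFDerivAt (fun y => ‖g‖⁻¹ • f y) (innerSL ℝ e) y₀ := by
    have := hf.const_smul ‖g‖⁻¹
    rwa [← map_smul] at this
  obtain ⟨U, hU, H⟩ := exists_nhds_almost_isometric he hf' (F := F)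
    (fun y hy => by simp [hF y hy]) hP hker (K := K) (by exact_mod_cast hK)
  refine ⟨U, hU, fun A hA => ?_⟩
  set π : E → (ℝ ∙ e)ᗮ := (ℝ ∙ e)ᗮ.orthogonalProjectionOnto with hπ
  have hLim : ∀ B : Set (ℝ ∙ e)ᗮ, μH[(d : ℝ)] (L '' B) =
      ENNReal.ofReal (|⟪u, e⟫| / ‖y₀ - x‖ ^ d) * μH[(d : ℝ)] B := fun B => by
    have := L.hausdorffMeasure_image B
    rwa [hfin, hdet] at this
  have hLπ : (fun y => L (π y)) '' A = L '' (π '' A) := (image_image _ _ _).symm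
  have i1 : μH[(d : ℝ)] (π '' A) ≤ μH[(d : ℝ)] A := by
    have := hausdorffMeasure_image_le_of_dist_le (A := A) (g := π) (h := id) (K := 1) d
      (fun y _ y' _ => by
        rw [dist_eq_norm, hπ, ← map_sub, NNReal.coe_one, one_mul, id, id, dist_eq_norm]
        exact Submodule.norm_orthogonalProjectionOnto_apply_le _ _)
    simpa using this
  have i2 : μH[(d : ℝ)] A ≤ (K : ℝ≥0∞) ^ d * μH[(d : ℝ)] (π '' A) := by
    have := hausdorffMeasure_image_le_of_dist_le (A := A) (g := id) (h := π) (K := K) d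
      (fun y hy y' hy' => by
        rw [dist_eq_norm, dist_eq_norm, hπ, ← map_sub]
        exact (H y (hA hy) y' (hA hy')).1)
    simpa using this
  have i3 : μH[(d : ℝ)] (P '' A) ≤ (K : ℝ≥0∞) ^ d * μH[(d : ℝ)] (L '' (π '' A)) := by
    rw [← hLπ]
    refine hausdorffMeasure_image_le_of_dist_le d fun y hy y' hy' => ?_
    rw [dist_eq_norm, dist_eq_norm, ← map_sub, hπ, ← map_sub]
    exact (H y (hA hy) y' (hA hy')).2.1
  have i4 : μH[(d : ℝ)] (L '' (π '' A)) ≤ (K : ℝ≥0∞) ^ d * μH[(d : ℝ)] (P '' A) := by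
    rw [← hLπ]
    refine hausdorffMeasure_image_le_of_dist_le d fun y hy y' hy' => ?_
    rw [dist_eq_norm, dist_eq_norm, ← map_sub, hπ, ← map_sub]
    exact (H y (hA hy) y' (hA hy')).2.2
  have hK1 : (1 : ℝ≥0∞) ≤ (K : ℝ≥0∞) ^ d := one_le_pow₀ (by exact_mod_cast hK.le)
  rw [hLim] at i3 i4
  set J := ENNReal.ofReal (|⟪u, e⟫| / ‖y₀ - x‖ ^ d) with hJ
  constructor
  · calc μH[(d : ℝ)] (P '' A) ≤ (K : ℝ≥0∞) ^ d * (J * μH[(d : ℝ)] (π '' A)) := i3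
      _ ≤ (K : ℝ≥0∞) ^ d * (J * μH[(d : ℝ)] A) := by gcongr
      _ ≤ (K : ℝ≥0∞) ^ (2 * d) * (J * μH[(d : ℝ)] A) := by
          gcongr
          · exact_mod_cast hK.le
          · omega
  · calc J * μH[(d : ℝ)] A ≤ J * ((K : ℝ≥0∞) ^ d * μH[(d : ℝ)] (π '' A)) := by gcongr
      _ = (K : ℝ≥0∞) ^ d * (J * μH[(d : ℝ)] (π '' A)) := by ring
      _ ≤ (K : ℝ≥0∞) ^ d * ((K : ℝ≥0∞) ^ d * μH[(d : ℝ)] (P '' A)) := by gcongr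
      _ = (K : ℝ≥0∞) ^ (2 * d) * μH[(d : ℝ)] (P '' A) := by ring

end Local

section Global

variable {E : Type*} [NormedAddCommGroup E] [InnerProductSpace ℝ E] [FiniteDimensional ℝ E]
  [MeasurableSpace E] [BorelSpace E]

/-- The inverse `Q` of the radial projection from `x` transports the Hausdorff measure of the unit
sphere to the measure on the level set `F` whose density is the Jacobian of the projection. -/
theorem map_hausdorffMeasure_sphere_eq_withDensity {d : ℕ} (hd : finrank ℝ E = d + 1)
    {F : Set E} (hFc : IsClosed F) {x : E} {f : E → ℝ} {G : E → E} (hG : Continuous G)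
    (hf : ∀ y ∈ F, HasStrictFDerivAt f (innerSL ℝ (G y)) y) (hF : ∀ y ∈ F, f y = 0)
    (hin : ∀ y ∈ F, ⟪y - x, G y⟫ ≠ 0) {Q : E → E} (hQ : Measurable Q)
    (hQF : ∀ u ∈ Metric.sphere (0 : E) 1, Q u ∈ F)
    (hPQ : ∀ u ∈ Metric.sphere (0 : E) 1, ‖Q u - x‖⁻¹ • (Q u - x) = u)
    (hQP : ∀ y ∈ F, Q (‖y - x‖⁻¹ • (y - x)) = y) :
    ((μH[(d : ℝ)] : Measure E).restrict (Metric.sphere 0 1)).map Q =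
      ((μH[(d : ℝ)] : Measure E).restrict F).withDensity (fun y => ENNReal.ofReal
        (|⟪‖y - x‖⁻¹ • (y - x), ‖G y‖⁻¹ • G y⟫| / ‖y - x‖ ^ d)) := by
  set S := Metric.sphere (0 : E) 1 with hS
  set ρ : E → ℝ := fun y => |⟪‖y - x‖⁻¹ • (y - x), ‖G y‖⁻¹ • G y⟫| / ‖y - x‖ ^ d with hρ
  set κ := ((μH[(d : ℝ)] : Measure E).restrict S).map Q with hκ
  set m := ((μH[(d : ℝ)] : Measure E).restrict F).withDensity (fun y => ENNReal.ofReal (ρ y))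
    with hm
  set P : E → E := fun y => ‖y - x‖⁻¹ • (y - x) with hP
  have hyx : ∀ y ∈ F, y - x ≠ 0 := fun y hy h => hin y hy (by rw [h, inner_zero_left])
  have hGn : ∀ y ∈ F, G y ≠ 0 := fun y hy h => hin y hy (by rw [h, inner_zero_right])
  have hκA : ∀ A, MeasurableSet A → κ A = μH[(d : ℝ)] (P '' (A ∩ F)) := fun A hA => by
    rw [hκ, Measure.map_apply hQ hA, Measure.restrict_apply (hQ hA)]
    congr 1
    ext u
    constructor
    · rintro ⟨hu1, hu2⟩
      exact ⟨Q u, ⟨hu1, hQF u hu2⟩, hPQ u hu2⟩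
    · rintro ⟨y, ⟨hyA, hyF⟩, rfl⟩
      refine ⟨?_, ?_⟩
      · change Q (P y) ∈ A
        rwa [hQP y hyF]
      · rw [hS, mem_sphere_zero_iff_norm]
        exact norm_smul_inv_norm (hyx y hyF)
  have hmA : ∀ A, MeasurableSet A → m A = ∫⁻ y in A ∩ F, ENNReal.ofReal (ρ y) ∂μH[(d : ℝ)] :=
    fun A hA => by
      rw [hm, withDensity_apply _ hA, Measure.restrict_restrict hA]
  have key : ∀ K : ℝ≥0, 1 < K → ∀ y₀, ∃ U ∈ 𝓝 y₀, ∀ A ⊆ U, MeasurableSet A →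
      κ A ≤ (K : ℝ≥0∞) ^ (2 * d + 1) * m A ∧ m A ≤ (K : ℝ≥0∞) ^ (2 * d + 1) * κ A := by
    intro K hK y₀
    by_cases hy₀ : y₀ ∈ F
    swap
    · refine ⟨Fᶜ, hFc.isOpen_compl.mem_nhds hy₀, fun A hA hAm => ?_⟩
      have hAF : A ∩ F = ∅ := (disjoint_left.2 fun a ha => hA ha).inter_eq
      simp [hκA A hAm, hmA A hAm, hAF]
    obtain ⟨U, hU, H⟩ := exists_nhds_hausdorffMeasure_radial hd (hGn y₀ hy₀) (hf y₀ hy₀) hF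
      (hin y₀ hy₀) hK
    change ∀ A ⊆ U ∩ F, μH[(d : ℝ)] (P '' A) ≤
        (K : ℝ≥0∞) ^ (2 * d) * (ENNReal.ofReal (ρ y₀) * μH[(d : ℝ)] A) ∧
      ENNReal.ofReal (ρ y₀) * μH[(d : ℝ)] A ≤ (K : ℝ≥0∞) ^ (2 * d) * μH[(d : ℝ)] (P '' A) at H
    have hn1 : ‖y₀ - x‖ ≠ 0 := norm_ne_zero_iff.2 (hyx y₀ hy₀)
    have hn2 : ‖G y₀‖ ≠ 0 := norm_ne_zero_iff.2 (hGn y₀ hy₀)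
    have hρc : ContinuousAt ρ y₀ := by
      have c1 : ContinuousAt (fun y => y - x) y₀ := by fun_prop
      have c2 : ContinuousAt G y₀ := hG.continuousAt
      exact ((((c1.norm.inv₀ hn1).smul c1).inner ((c2.norm.inv₀ hn2).smul c2)).abs).div
        (c1.norm.pow d) (pow_ne_zero _ hn1)
    have hρ0 : 0 < ρ y₀ := by
      have := hin y₀ hy₀
      simp only [hρ, real_inner_smul_left, real_inner_smul_right]
      positivity
    have hKr : (1 : ℝ) < K := by exact_mod_cast hK
    have hV1 : ∀ᶠ y in 𝓝 y₀, ρ y < K * ρ y₀ := hρc.eventually_lt_const (by nlinarith)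
    have hV2 : ∀ᶠ y in 𝓝 y₀, ρ y₀ < K * ρ y :=
      (hρc.const_mul (K : ℝ)).eventually_const_lt (by nlinarith)
    refine ⟨U ∩ {y | ρ y < K * ρ y₀ ∧ ρ y₀ < K * ρ y}, inter_mem hU (hV1.and hV2),
      fun A hA hAm => ?_⟩
    obtain ⟨H1, H2⟩ := H (A ∩ F) (inter_subset_inter_left F (hA.trans inter_subset_left))
    have hBm : MeasurableSet (A ∩ F) := hAm.inter hFc.measurableSet
    rw [← hκA A hAm] at H1 H2
    have I1 : ENNReal.ofReal (ρ y₀) * μH[(d : ℝ)] (A ∩ F) ≤ K * m A := by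
      rw [hmA A hAm, ← setLIntegral_const, ← lintegral_const_mul' _ _ ENNReal.coe_ne_top]
      refine setLIntegral_mono' hBm fun y hy => ?_
      rw [← ENNReal.ofReal_coe_nnreal, ← ENNReal.ofReal_mul K.coe_nonneg]
      exact ENNReal.ofReal_le_ofReal (hA hy.1).2.2.le
    have I2 : m A ≤ K * (ENNReal.ofReal (ρ y₀) * μH[(d : ℝ)] (A ∩ F)) := by
      rw [hmA A hAm, ← setLIntegral_const, ← lintegral_const_mul' _ _ ENNReal.coe_ne_top]
      refine setLIntegral_mono' hBm fun y hy => ?_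
      rw [← ENNReal.ofReal_coe_nnreal, ← ENNReal.ofReal_mul K.coe_nonneg]
      exact ENNReal.ofReal_le_ofReal (hA hy.1).2.1.le
    constructor
    · calc κ A ≤ (K : ℝ≥0∞) ^ (2 * d) * (K * m A) := H1.trans (by gcongr)
        _ = (K : ℝ≥0∞) ^ (2 * d + 1) * m A := by ring
    · calc m A ≤ K * ((K : ℝ≥0∞) ^ (2 * d) * κ A) := I2.trans (by gcongr)
        _ = (K : ℝ≥0∞) ^ (2 * d + 1) * κ A := by ring
  have hlim : ∀ c : ℝ≥0∞, Tendsto (fun K : ℝ≥0 => (K : ℝ≥0∞) ^ (2 * d + 1) * c) (𝓝[>] 1)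
      (𝓝 c) := by
    intro c
    have h1 : Tendsto (fun K : ℝ≥0 => ((K ^ (2 * d + 1) : ℝ≥0) : ℝ≥0∞)) (𝓝[>] 1) (𝓝 1) := by
      have : Continuous (fun K : ℝ≥0 => ((K ^ (2 * d + 1) : ℝ≥0) : ℝ≥0∞)) := by fun_prop
      simpa using (this.tendsto 1).mono_left nhdsWithin_le_nhds
    have := ENNReal.Tendsto.mul_const (b := c) h1 (Or.inl one_ne_zero)
    simpa using this
  refine le_antisymm (Measure.le_iff.2 fun A hA => ?_) (Measure.le_iff.2 fun A hA => ?_)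
  · refine ge_of_tendsto (hlim (m A)) (eventually_mem_nhdsWithin.mono fun K hK => ?_)
    exact measure_le_smul_of_locally_s4 κ m _ (fun y => by
      obtain ⟨U, hU, H⟩ := key K hK y
      exact ⟨U, hU, fun B hB hBm => (H B hB hBm).1⟩) A
  · refine ge_of_tendsto (hlim (κ A)) (eventually_mem_nhdsWithin.mono fun K hK => ?_)
    exact measure_le_smul_of_locally_s4 m κ _ (fun y => by
      obtain ⟨U, hU, H⟩ := key K hK y
      exact ⟨U, hU, fun B hB hBm => (H B hB hBm).2⟩) A

end Global

section InnerProduct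

variable {E : Type*} [NormedAddCommGroup E] [InnerProductSpace ℝ E]

/-- Integrals of `|⟪w, ·⟫|` over the unit sphere do not depend on the unit vector `w`. -/
theorem integral_sphere_abs_inner_eq [MeasurableSpace E] [BorelSpace E] (d : ℝ) {w v : E}
    (h : ‖w‖ = ‖v‖) :
    ∫ u in Metric.sphere (0 : E) 1, |⟪w, u⟫| ∂μH[d] =
      ∫ u in Metric.sphere (0 : E) 1, |⟪v, u⟫| ∂μH[d] := by
  set R : E ≃ₗᵢ[ℝ] E := (ℝ ∙ (w - v))ᗮ.reflection
  have hR : R w = v := Submodule.reflection_sub h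
  have hmp := R.toIsometryEquiv.measurePreserving_hausdorffMeasure d
  have hpre : R.toIsometryEquiv ⁻¹' Metric.sphere (0 : E) 1 = Metric.sphere (0 : E) 1 := by
    ext u; simp
  have := hmp.setIntegral_preimage_emb R.toIsometryEquiv.toHomeomorph.measurableEmbedding
    (fun u => |⟪v, u⟫|) (Metric.sphere (0 : E) 1)
  rw [hpre] at this
  rw [← this]
  refine integral_congr_ae (Eventually.of_forall fun u => ?_)
  change |⟪w, u⟫| = |⟪v, R u⟫|
  rw [← hR, R.inner_map_map]

/-- At a boundary point of a convex open sublevel set, the gradient of the defining function is not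
orthogonal to the direction from an interior point. -/
theorem inner_sub_gradient_ne_zero {Ω : Set E} (hΩ : IsOpen Ω) (hconv : Convex ℝ Ω) {f : E → ℝ}
    (hneg : ∀ z ∈ Ω, f z < 0) {y g : E} (hy : y ∈ closure Ω) (hfy : f y = 0)
    (hf : HasFDerivAt f (innerSL ℝ g) y) (hg : g ≠ 0) {x : E} (hx : x ∈ Ω) :
    ⟪y - x, g⟫ ≠ 0 := by
  have hle : ∀ z ∈ Ω, ⟪g, z - y⟫ ≤ 0 := by
    intro z hz
    have hline : HasDerivAt (fun t : ℝ => f (y + t • (z - y))) ⟪g, z - y⟫ 0 := by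
      have hl : HasDerivAt (fun t : ℝ => y + t • (z - y)) (z - y) 0 := by
        simpa using ((hasDerivAt_id (0 : ℝ)).smul_const (z - y)).const_add y
      have hf0 : HasFDerivAt f (innerSL ℝ g) (y + (0 : ℝ) • (z - y)) := by simpa using hf
      exact hf0.comp_hasDerivAt (0 : ℝ) hl
    have ht := hline.tendsto_slope_zero_right
    refine le_of_tendsto ht ?_
    filter_upwards [Ioo_mem_nhdsGT (zero_lt_one' ℝ)] with t ht
    have hmem : y + t • (z - y) ∈ Ω := by
      have h := hconv.combo_interior_closure_mem_interior (x := z) (y := y)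
        (by rwa [hΩ.interior_eq]) hy ht.1 (by linarith [ht.2] : (0 : ℝ) ≤ 1 - t) (by ring)
      rw [hΩ.interior_eq] at h
      convert h using 1
      module
    have := hneg _ hmem
    simp only [zero_add, zero_smul, add_zero, hfy, sub_zero, smul_eq_mul]
    exact mul_nonpos_of_nonneg_of_nonpos (inv_nonneg.2 ht.1.le) this.le
  intro h0
  obtain ⟨r, hr, hball⟩ := Metric.isOpen_iff.1 hΩ x hx
  have hgn : 0 < ‖g‖ := norm_pos_iff.2 hg
  set t : ℝ := r / (2 * ‖g‖) with ht
  have ht0 : 0 < t := by positivity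
  have hz : x + t • g ∈ Ω := hball (by
    rw [mem_ball_iff_norm, add_sub_cancel_left, norm_smul, Real.norm_of_nonneg ht0.le, ht]
    field_simp
    linarith)
  have := hle _ hz
  have e : x + t • g - y = t • g - (y - x) := by abel
  rw [e, inner_sub_right, real_inner_smul_right, real_inner_self_eq_norm_sq,
    real_inner_comm, h0] at this
  have : 0 < t * ‖g‖ ^ 2 := by positivity
  linarith

end InnerProduct

section Frontier

variable {E : Type*} [NormedAddCommGroup E] [InnerProductSpace ℝ E] [FiniteDimensional ℝ E]
  [MeasurableSpace E] [BorelSpace E]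

/-- The boundary integral of a bounded convex body with `C¹` boundary, seen from an interior
point, is an integral over the unit sphere. -/
theorem integral_frontier_eq_integral_sphere {d : ℕ} (hd : finrank ℝ E = d + 1) {Ω : Set E}
    (hΩopen : IsOpen Ω) (hΩbdd : Bornology.IsBounded Ω) (hΩconv : Convex ℝ Ω)
    {f : E → ℝ} (hf : ContDiff ℝ 1 f) (hΩf : Ω = {x | f x < 0})
    (hfr : frontier Ω = {x | f x = 0}) (hgrad : ∀ x ∈ frontier Ω, gradient f x ≠ 0)
    {ν : E → E} (hν : ∀ y ∈ frontier Ω, ν y = ‖gradient f y‖⁻¹ • gradient f y)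
    {x : E} (hx : x ∈ Ω) (w : E) :
    ∫ y in frontier Ω, |⟪w, y - x⟫ * ⟪y - x, ν y⟫| / ‖x - y‖ ^ (d + 1 + 1) ∂μH[(d : ℝ)] =
      ∫ u in Metric.sphere (0 : E) 1, |⟪w, u⟫| ∂μH[(d : ℝ)] := by
  set F := frontier Ω with hFdef
  set G : E → E := gradient f with hGdef
  have hG : Continuous G :=
    (InnerProductSpace.toDual ℝ E).symm.continuous.comp (hf.continuous_fderiv one_ne_zero)
  have hfG : ∀ y, HasStrictFDerivAt f (innerSL ℝ (G y)) y := fun y => by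
    have h1 := hf.contDiffAt.hasStrictFDerivAt (x := y) one_ne_zero
    have h2 : innerSL ℝ (G y) = fderiv ℝ f y := by
      ext v
      simp [hGdef, gradient]
    rwa [h2]
  have hF : ∀ y ∈ F, f y = 0 := fun y hy => by rw [hfr] at hy; exact hy
  have hin : ∀ y ∈ F, ⟪y - x, G y⟫ ≠ 0 := fun y hy =>
    inner_sub_gradient_ne_zero hΩopen hΩconv (fun z hz => by rw [hΩf] at hz; exact hz)
      (frontier_subset_closure hy) (hF y hy) (hfG y).hasFDerivAt (hgrad y hy) hx
  -- the gauge of `Ω` centred at `x` gives the inverse of the radial projection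
  set Ω₀ : Set E := (fun z => x + z) ⁻¹' Ω with hΩ₀
  have hΩ₀c : Convex ℝ Ω₀ := hΩconv.translate_preimage_right x
  have hΩ₀n : Ω₀ ∈ 𝓝 (0 : E) :=
    (hΩopen.preimage (continuous_const.add continuous_id)).mem_nhds (by simpa [hΩ₀] using hx)
  have hΩ₀b : Bornology.IsBounded Ω₀ := by
    have : Ω₀ = (fun z => -x + z) '' Ω := by
      rw [image_add_left, neg_neg]
    rw [this]
    exact (isometry_add_left (-x)).lipschitz.isBounded_image hΩbdd
  have hgF : ∀ z, gauge Ω₀ z = 1 ↔ x + z ∈ F := fun z => by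
    rw [gauge_eq_one_iff_mem_frontier hΩ₀c hΩ₀n]
    have := (Homeomorph.addLeft x).preimage_frontier Ω
    exact (Set.ext_iff.1 this z).symm
  have hgpos : ∀ z, z ≠ 0 → 0 < gauge Ω₀ z := fun z hz =>
    (gauge_pos (absorbent_nhds_zero hΩ₀n) (NormedSpace.isVonNBounded_of_isBounded ℝ hΩ₀b)).2 hz
  set Q : E → E := fun u => x + (gauge Ω₀ u)⁻¹ • u with hQdef
  have hQ : Measurable Q :=
    (((continuous_gauge hΩ₀c hΩ₀n).measurable.inv).smul measurable_id).const_add x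
  have hS0 : ∀ u ∈ Metric.sphere (0 : E) 1, u ≠ 0 := fun u hu => ne_zero_of_mem_unit_sphere ⟨u, hu⟩
  have hQF : ∀ u ∈ Metric.sphere (0 : E) 1, Q u ∈ F := fun u hu => by
    have h0 := hgpos u (hS0 u hu)
    rw [hQdef, ← hgF, gauge_smul_of_nonneg (inv_nonneg.2 h0.le), smul_eq_mul,
      inv_mul_cancel₀ h0.ne']
  have hPQ : ∀ u ∈ Metric.sphere (0 : E) 1, ‖Q u - x‖⁻¹ • (Q u - x) = u := fun u hu => by
    have h0 := hgpos u (hS0 u hu)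
    have h1 : ‖u‖ = 1 := mem_sphere_zero_iff_norm.1 hu
    rw [hQdef]
    simp only [add_sub_cancel_left, norm_smul, h1, mul_one, norm_inv, inv_inv,
      Real.norm_of_nonneg h0.le, smul_smul, mul_inv_cancel₀ h0.ne', one_smul]
  have hyx : ∀ y ∈ F, 0 < ‖y - x‖ := fun y hy =>
    norm_pos_iff.2 fun h => hin y hy (by rw [h, inner_zero_left])
  have hQP : ∀ y ∈ F, Q (‖y - x‖⁻¹ • (y - x)) = y := fun y hy => by
    have h0 := hyx y hy
    have h1 : gauge Ω₀ (y - x) = 1 := (hgF _).2 (by rwa [add_sub_cancel])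
    rw [hQdef]
    simp only [gauge_smul_of_nonneg (inv_nonneg.2 h0.le), h1, smul_eq_mul, mul_one, inv_inv,
      smul_smul, mul_inv_cancel₀ h0.ne', one_smul, add_sub_cancel]
  have hmap := map_hausdorffMeasure_sphere_eq_withDensity hd isClosed_frontier hG
    (fun y _ => hfG y) hF hin hQ hQF hPQ hQP
  have hρm : Measurable fun y : E =>
      |⟪‖y - x‖⁻¹ • (y - x), ‖G y‖⁻¹ • G y⟫| / ‖y - x‖ ^ d := by
    have m1 : Measurable fun y : E => y - x := measurable_id.sub_const x
    have m2 := hG.measurable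
    have m3 : Measurable fun y : E => ⟪‖y - x‖⁻¹ • (y - x), ‖G y‖⁻¹ • G y⟫ :=
      (m1.norm.inv.smul m1).inner (m2.norm.inv.smul m2)
    exact (continuous_abs.measurable.comp m3).div (m1.norm.pow_const d)
  have hPm : Measurable fun y : E => |⟪w, ‖y - x‖⁻¹ • (y - x)⟫| := by
    have m1 : Measurable fun y : E => y - x := measurable_id.sub_const x
    exact continuous_abs.measurable.comp (measurable_const.inner (m1.norm.inv.smul m1))
  have hFm : MeasurableSet F := isClosed_frontier.measurableSet
  calc ∫ y in F, |⟪w, y - x⟫ * ⟪y - x, ν y⟫| / ‖x - y‖ ^ (d + 1 + 1) ∂μH[(d : ℝ)]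
      = ∫ y in F, (ENNReal.ofReal (|⟪‖y - x‖⁻¹ • (y - x), ‖G y‖⁻¹ • G y⟫| / ‖y - x‖ ^ d)).toReal •
          |⟪w, ‖y - x‖⁻¹ • (y - x)⟫| ∂μH[(d : ℝ)] := by
        refine setIntegral_congr_fun hFm fun y hy => ?_
        have h0 := hyx y hy
        rw [ENNReal.toReal_ofReal (by positivity), hν y hy, norm_sub_rev x y]
        simp only [real_inner_smul_left, real_inner_smul_right, abs_mul, abs_inv, abs_norm,
          smul_eq_mul]
        field_simp
        ring
    _ = ∫ u in Metric.sphere (0 : E) 1, |⟪w, ‖Q u - x‖⁻¹ • (Q u - x)⟫| ∂μH[(d : ℝ)] := by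
        rw [← integral_withDensity_eq_integral_toReal_smul hρm.ennreal_ofReal
          (Eventually.of_forall fun _ => ENNReal.ofReal_lt_top), ← hmap,
          integral_map hQ.aemeasurable hPm.aestronglyMeasurable]
    _ = ∫ u in Metric.sphere (0 : E) 1, |⟪w, u⟫| ∂μH[(d : ℝ)] :=
        setIntegral_congr_fun Metric.isClosed_sphere.measurableSet fun u hu => by
          simp only [hPQ u hu]

end Frontier

/-- For a bounded open convex set `Ω ⊆ ℝⁿ` (n ≥ 2) with `C¹` boundary
and outward unit normal `ν`, for every interior point `x ∈ Ω` and every unit vector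
`w`, one has `∫_{∂Ω} |⟨w, y-x⟩⟨y-x, ν(y)⟩| / ‖x-y‖^{n+1} dσ(y) = 2 c_n`,
where `c_n = (1/2) ∫_{S^{n-1}} |u₁| dσ(u)`. -/
theorem statement4 (n : ℕ) (hn : 2 ≤ n)
    (Ω : Set (EuclideanSpace ℝ (Fin n)))
    (hΩopen : IsOpen Ω) (hΩbdd : Bornology.IsBounded Ω) (hΩconv : Convex ℝ Ω)
    (f : EuclideanSpace ℝ (Fin n) → ℝ) (hf : ContDiff ℝ 1 f)
    (hΩf : Ω = {x | f x < 0})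
    (hfr : frontier Ω = {x | f x = 0})
    (hgrad : ∀ x ∈ frontier Ω, gradient f x ≠ 0)
    (ν : EuclideanSpace ℝ (Fin n) → EuclideanSpace ℝ (Fin n))
    (hν : ∀ y ∈ frontier Ω, ν y = ‖gradient f y‖⁻¹ • gradient f y)
    (x : EuclideanSpace ℝ (Fin n)) (hx : x ∈ Ω)
    (w : EuclideanSpace ℝ (Fin n)) (hw : ‖w‖ = 1) :
    (∫ y in frontier Ω,
        |⟪w, y - x⟫ * ⟪y - x, ν y⟫| / ‖x - y‖ ^ (n + 1) ∂(μH[(n : ℝ) - 1]))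
      = 2 * ((1 : ℝ) / 2 *
          ∫ u in Metric.sphere (0 : EuclideanSpace ℝ (Fin n)) 1,
            |u ⟨0, by omega⟩| ∂(μH[(n : ℝ) - 1])) := by
  obtain ⟨d, rfl⟩ : ∃ d, n = d + 1 := ⟨n - 1, by omega⟩
  have hdc : ((d + 1 : ℕ) : ℝ) - 1 = (d : ℝ) := by push_cast; ring
  rw [hdc, integral_frontier_eq_integral_sphere (by simp) hΩopen hΩbdd hΩconv hf hΩf hfr hgrad hν
      hx w,
    integral_sphere_abs_inner_eq (v := EuclideanSpace.single ⟨0, by omega⟩ (1 : ℝ)) _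
      (by rw [hw]; simp),
    ← mul_assoc, mul_one_div_cancel two_ne_zero, one_mul]
  simp [EuclideanSpace.inner_single_left]
end

section
/- Let n ≥ 2 and let Ω ⊂ ℝⁿ be a bounded open set with C¹ boundary. If Ω is not convex, then there exists a line ℓ ⊂ ℝⁿ (the set {p + t·v : t ∈ ℝ} for some point p and nonzero direction v) whose intersection with the frontier of Ω contains at least 4 distinct points. -/
open MeasureTheory

/-- A line on which a continuous function changes sign from negative to positive and back, and
is nonnegative far away on both sides, meets the zero set in at least four points. -/
theorem four_le_encard_line_inter_zeros {E : Type*} [AddCommGroup E] [Module ℝ E] {f : E → ℝ}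
    {p v : E} (hv : v ≠ 0) (hcont : Continuous fun t : ℝ => f (p + t • v)) {a b c d e : ℝ}
    (hab : a ≤ b) (hbc : b ≤ c) (hcd : c ≤ d) (hde : d ≤ e)
    (ha : 0 ≤ f (p + a • v)) (hb : f (p + b • v) < 0) (hc : 0 < f (p + c • v))
    (hd : f (p + d • v) < 0) (he : 0 ≤ f (p + e • v)) :
    4 ≤ ({x | ∃ t : ℝ, x = p + t • v} ∩ {x | f x = 0}).encard := by
  obtain ⟨t₁, h₁, z₁⟩ := intermediate_value_Ico' hab hcont.continuousOn ⟨hb, ha⟩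
  obtain ⟨t₂, h₂, z₂⟩ := intermediate_value_Ioo hbc hcont.continuousOn ⟨hb, hc⟩
  obtain ⟨t₃, h₃, z₃⟩ := intermediate_value_Ioo' hcd hcont.continuousOn ⟨hd, hc⟩
  obtain ⟨t₄, h₄, z₄⟩ := intermediate_value_Ioc hde hcont.continuousOn ⟨hd, he⟩
  have h₁₂ : t₁ < t₂ := h₁.2.trans h₂.1
  have h₂₃ : t₂ < t₃ := h₂.2.trans h₃.1
  have h₃₄ : t₃ < t₄ := h₃.2.trans h₄.1
  have hinj : Function.Injective fun t : ℝ => p + t • v :=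
    (add_right_injective p).comp (smul_left_injective ℝ hv)
  have hcard : ({t₁, t₂, t₃, t₄} : Set ℝ).encard = 4 := by
    rw [Set.encard_insert_of_notMem, Set.encard_insert_of_notMem,
      Set.encard_pair h₃₄.ne]
    · norm_num
    · simp [h₂₃.ne, (h₂₃.trans h₃₄).ne]
    · simp [h₁₂.ne, (h₁₂.trans h₂₃).ne, (h₁₂.trans (h₂₃.trans h₃₄)).ne]
  rw [← hcard, ← hinj.encard_image]
  apply Set.encard_le_encard
  rintro _ ⟨t, rfl | rfl | rfl | rfl, rfl⟩
  exacts [⟨⟨_, rfl⟩, z₁⟩, ⟨⟨_, rfl⟩, z₂⟩, ⟨⟨_, rfl⟩, z₃⟩, ⟨⟨_, rfl⟩, z₄⟩]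

/-- A line leaves a bounded set far away in both directions. -/
theorem Bornology.IsBounded.exists_add_smul_notMem {E : Type*} [NormedAddCommGroup E]
    [NormedSpace ℝ E] {s : Set E} (hs : Bornology.IsBounded s) (p : E) {v : E} (hv : v ≠ 0) :
    ∃ T : ℝ, 1 < T ∧ p + T • v ∉ s ∧ p + (-T) • v ∉ s := by
  obtain ⟨R, hR⟩ := hs.exists_norm_le
  have hv' : 0 < ‖v‖ := norm_pos_iff.2 hv
  have key : ∀ t : ℝ, (R + ‖p‖) / ‖v‖ < |t| → p + t • v ∉ s := by
    intro t ht hmem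
    rw [div_lt_iff₀ hv'] at ht
    have h₁ := hR _ hmem
    have h₂ : ‖t • v‖ ≤ ‖p + t • v‖ + ‖p‖ := by
      simpa using norm_sub_le (p + t • v) p
    rw [norm_smul, Real.norm_eq_abs] at h₂
    linarith
  have hT : 0 < max ((R + ‖p‖) / ‖v‖) 1 + 1 := by positivity
  refine ⟨max ((R + ‖p‖) / ‖v‖) 1 + 1, ?_, key _ ?_, key _ ?_⟩
  · linarith [le_max_right ((R + ‖p‖) / ‖v‖) 1]
  · rw [abs_of_pos hT]
    linarith [le_max_left ((R + ‖p‖) / ‖v‖) 1]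
  · rw [abs_neg, abs_of_pos hT]
    linarith [le_max_left ((R + ‖p‖) / ‖v‖) 1]

/-- If an open strict sublevel set has no critical points on the zero level and is not convex,
then some segment joining two of its points contains a point where the function is positive. -/
theorem exists_pos_on_segment_of_not_convex {E : Type*} [NormedAddCommGroup E]
    [NormedSpace ℝ E] {f : E → ℝ} (hf : Continuous f)
    (hcrit : ∀ x, f x = 0 → fderiv ℝ f x ≠ 0) (hnc : ¬ Convex ℝ {x | f x < 0}) :
    ∃ x y, f x < 0 ∧ f y < 0 ∧ ∃ t ∈ Set.Icc (0 : ℝ) 1, 0 < f (x + t • (y - x)) := by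
  contrapose! hnc
  intro x hx y hy a b ha hb hab
  have hmem : ∀ᶠ w in nhds (0 : E), f (x + w) < 0 ∧ f (y + w) < 0 := by
    refine Filter.Eventually.and ?_ ?_
    · exact (by fun_prop : Continuous fun w => f (x + w)).continuousAt.eventually_lt_const
        (by simpa using hx)
    · exact (by fun_prop : Continuous fun w => f (y + w)).continuousAt.eventually_lt_const
        (by simpa using hy)
  have hle : ∀ᶠ w in nhds (0 : E), f (a • x + b • y + w) ≤ 0 := by
    filter_upwards [hmem] with w hw
    have h := hnc _ _ hw.1 hw.2 b ⟨hb, by linarith⟩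
    obtain rfl : a = 1 - b := by linarith
    rwa [show x + w + b • (y + w - (x + w)) = (1 - b) • x + b • y + w by module] at h
  have hz : f (a • x + b • y) ≤ 0 := by simpa using hle.self_of_nhds
  refine lt_of_le_of_ne hz fun h0 => hcrit _ h0 (IsLocalMax.fderiv_eq_zero ?_)
  have ht : Filter.Tendsto (fun u => u - (a • x + b • y)) (nhds (a • x + b • y)) (nhds 0) := by
    simpa using (continuous_id.sub continuous_const).tendsto (a • x + b • y)
      (f := fun u : E => u - (a • x + b • y))
  filter_upwards [ht.eventually hle] with u hu
  rw [h0]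
  simpa using hu

/-- If a bounded open set `Ω ⊆ ℝⁿ` (n ≥ 2) with `C¹` boundary is not
convex, then some line `{p + t • v : t ∈ ℝ}` (with `v ≠ 0`) intersects the frontier
of `Ω` in at least 4 distinct points. -/
theorem statement5 (n : ℕ) (hn : 2 ≤ n)
    (Ω : Set (EuclideanSpace ℝ (Fin n)))
    (hΩopen : IsOpen Ω) (hΩbdd : Bornology.IsBounded Ω)
    (f : EuclideanSpace ℝ (Fin n) → ℝ) (hf : ContDiff ℝ 1 f)
    (hΩf : Ω = {x | f x < 0})
    (hfr : frontier Ω = {x | f x = 0})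
    (hgrad : ∀ x ∈ frontier Ω, gradient f x ≠ 0)
    (hnc : ¬ Convex ℝ Ω) :
    ∃ (p v : EuclideanSpace ℝ (Fin n)), v ≠ 0 ∧
      4 ≤ ({x | ∃ t : ℝ, x = p + t • v} ∩ frontier Ω).encard := by
  subst hΩf
  rw [hfr] at hgrad ⊢
  have hcrit : ∀ x, f x = 0 → fderiv ℝ f x ≠ 0 := fun x hx h =>
    hgrad x hx (by simp [gradient, h])
  obtain ⟨x, y, hx, hy, t, ht, hpos⟩ :=
    exists_pos_on_segment_of_not_convex hf.continuous hcrit hnc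
  have hv : y - x ≠ 0 := by
    intro h
    rw [h, smul_zero, add_zero] at hpos
    exact hpos.not_gt hx
  obtain ⟨T, hT, hT₁, hT₂⟩ := hΩbdd.exists_add_smul_notMem x hv
  have hcont : Continuous fun s : ℝ => f (x + s • (y - x)) :=
    hf.continuous.comp (by fun_prop)
  exact ⟨x, y - x, hv, four_le_encard_line_inter_zeros hv hcont (by linarith : -T ≤ 0) ht.1 ht.2
    hT.le (not_lt.1 hT₂) (by simpa using hx) hpos (by simpa using hy) (not_lt.1 hT₁)⟩
end

section
/- Let n ≥ 2. Then ∫_{S^{n−1}} ∫_{S^{n−1}} (1 − ⟨x, y⟩)² / ‖x − y‖^{n+1} dσ(x) dσ(y) = c_n · σ(S^{n−1}), where c_n = (1/2) ∫_{S^{n−1}} |w₁| dσ(w). Equivalently, the inequality of the main theorem holds with equality for the unit ball. -/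
open MeasureTheory RealInnerProductSpace

open Set Metric Module
open scoped ENNReal

/-- The integral of a function of `‖x‖` and `⟪x, y⟫` against an isometry-invariant measure depends
on `y` only through its norm. -/
lemma lintegral_norm_inner_eq_of_norm_eq {E : Type*} [NormedAddCommGroup E]
    [InnerProductSpace ℝ E] [MeasurableSpace E] [BorelSpace E]
    {μ : Measure E} (hμ : ∀ T : E ≃ₗᵢ[ℝ] E, MeasurePreserving T μ μ)
    (G : ℝ → ℝ → ℝ≥0∞) {y z : E} (h : ‖y‖ = ‖z‖) :
    ∫⁻ x, G ‖x‖ ⟪x, y⟫ ∂μ = ∫⁻ x, G ‖x‖ ⟪x, z⟫ ∂μ := by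
  obtain ⟨T, hT⟩ : ∃ T : E ≃ₗᵢ[ℝ] E, T y = z := ⟨_, Submodule.reflection_sub h⟩
  rw [← (hμ T).lintegral_comp_emb T.toHomeomorph.measurableEmbedding (fun x ↦ G ‖x‖ ⟪x, z⟫)]
  simp [← hT]

/-- Double counting: comparison of the zonal integrals against a finite isometry-invariant measure
on the unit sphere with the corresponding integrals over the unit ball. -/
lemma lintegral_sphere_inner_mul_volume_ball {E : Type*} [NormedAddCommGroup E]
    [InnerProductSpace ℝ E] [MeasurableSpace E] [BorelSpace E] [FiniteDimensional ℝ E]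
    [Nontrivial E] {σ : Measure E} [IsFiniteMeasure σ]
    (hσ : ∀ T : E ≃ₗᵢ[ℝ] E, MeasurePreserving T σ σ) (hs : ∀ᵐ x ∂σ, x ∈ sphere (0 : E) 1)
    {g : ℝ → ℝ≥0∞} (hg : Measurable g) {e : E} (he : ‖e‖ = 1) :
    (∫⁻ x, g ⟪x, e⟫ ∂σ) * volume (ball (0 : E) 1) =
      (∫⁻ x in ball (0 : E) 1, g (⟪x, e⟫ / ‖x‖)) * σ univ := by
  have hvol (T : E ≃ₗᵢ[ℝ] E) : MeasurePreserving T
      (volume.restrict (ball (0 : E) 1)) (volume.restrict (ball (0 : E) 1)) := by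
    simpa using T.measurePreserving.restrict_preimage_emb
      T.toHomeomorph.measurableEmbedding (ball 0 1)
  calc (∫⁻ x, g ⟪x, e⟫ ∂σ) * volume (ball (0 : E) 1)
      = ∫⁻ _ in ball (0 : E) 1, (∫⁻ x, g ⟪x, e⟫ ∂σ) := by rw [setLIntegral_const]
    _ = ∫⁻ z in ball (0 : E) 1, (∫⁻ x, g (⟪z, x⟫ / ‖z‖) ∂σ) := by
      refine lintegral_congr_ae (ae_restrict_of_ae ?_)
      filter_upwards [compl_mem_ae_iff.2 (measure_singleton (μ := volume) (0 : E))] with z hz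
      have hz' : ‖z‖ ≠ 0 := norm_ne_zero_iff.2 hz
      rw [lintegral_norm_inner_eq_of_norm_eq hσ (fun _ t ↦ g t) (z := ‖z‖⁻¹ • z)
        (by simp [norm_smul, he, hz'])]
      refine lintegral_congr fun x ↦ ?_
      rw [real_inner_smul_right, real_inner_comm, inv_mul_eq_div]
    _ = ∫⁻ x, (∫⁻ z in ball (0 : E) 1, g (⟪z, x⟫ / ‖z‖)) ∂σ :=
      lintegral_lintegral_swap (by fun_prop)
    _ = ∫⁻ _, (∫⁻ z in ball (0 : E) 1, g (⟪z, e⟫ / ‖z‖)) ∂σ := by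
      refine lintegral_congr_ae ?_
      filter_upwards [hs] with x hx
      exact lintegral_norm_inner_eq_of_norm_eq hvol (fun r t ↦ g (t / r))
        (by simpa [he] using hx)
    _ = _ := by rw [lintegral_const]

/-- Integration of radial functions, for the Lebesgue integral. -/
lemma lintegral_comp_norm_addHaar {E : Type*} [NormedAddCommGroup E] [NormedSpace ℝ E]
    [MeasurableSpace E] [BorelSpace E] [FiniteDimensional ℝ E] [Nontrivial E]
    (μ : Measure E) [μ.IsAddHaarMeasure] {f : ℝ → ℝ≥0∞} (hf : Measurable f) :
    ∫⁻ x, f ‖x‖ ∂μ = μ.toSphere univ *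
      ∫⁻ r in Ioi (0 : ℝ), ENNReal.ofReal (r ^ (finrank ℝ E - 1)) * f r := by
  calc
    ∫⁻ x, f ‖x‖ ∂μ = ∫⁻ x : ({(0)}ᶜ : Set E), f ‖x.1‖ ∂(μ.comap (↑)) := by
      rw [lintegral_subtype_comap (measurableSet_singleton _).compl fun x ↦ f (‖x‖),
        restrict_compl_singleton]
    _ = ∫⁻ x, f x.2 ∂μ.toSphere.prod (.volumeIoiPow (finrank ℝ E - 1)) := by
      simpa using μ.measurePreserving_homeomorphUnitSphereProd.lintegral_comp_emb
        (Homeomorph.measurableEmbedding _) (f ∘ Subtype.val ∘ Prod.snd)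
    _ = μ.toSphere univ * ∫⁻ x : Ioi (0 : ℝ), f x ∂.volumeIoiPow (finrank ℝ E - 1) := by
      rw [lintegral_prod _ (by fun_prop)]
      simp [mul_comm]
    _ = _ := by
      rw [Measure.volumeIoiPow, lintegral_withDensity_eq_lintegral_mul _ (by fun_prop)
        (by fun_prop), ← lintegral_subtype_comap measurableSet_Ioi]
      rfl

/-- Integration in cylindrical coordinates around the first axis of `ℝ^(m+2)`. -/
lemma lintegral_cylindrical (m : ℕ) {G : ℝ → ℝ → ℝ≥0∞}
    (hG : Measurable (Function.uncurry G)) :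
    ∫⁻ x : EuclideanSpace ℝ (Fin (m + 2)), G (x 0) ‖x‖ =
      (volume : Measure (EuclideanSpace ℝ (Fin (m + 1)))).toSphere univ *
        ∫⁻ t, ∫⁻ r in Ioi (0 : ℝ), ENNReal.ofReal (r ^ m) * G t √(t ^ 2 + r ^ 2) := by
  have hG' : Measurable fun p : ℝ × ℝ ↦ G p.1 p.2 := hG
  calc ∫⁻ x : EuclideanSpace ℝ (Fin (m + 2)), G (x 0) ‖x‖
      = ∫⁻ p : Fin (m + 2) → ℝ, G (p 0) √(∑ i, p i ^ 2) := by
        rw [← (PiLp.volume_preserving_toLp (Fin (m + 2))).lintegral_comp_emb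
          (MeasurableEquiv.toLp 2 _).measurableEmbedding]
        simp [EuclideanSpace.norm_eq]
    _ = ∫⁻ p : ℝ × (Fin (m + 1) → ℝ), G p.1 √(p.1 ^ 2 + ∑ i, p.2 i ^ 2) := by
        rw [← (volume_preserving_piFinSuccAbove (fun _ ↦ ℝ) (0 : Fin (m + 2))).symm
          |>.lintegral_comp_emb (MeasurableEquiv.measurableEmbedding _)]
        simp [Fin.sum_univ_succ, MeasurableEquiv.piFinSuccAbove]
    _ = ∫⁻ t, ∫⁻ v : Fin (m + 1) → ℝ, G t √(t ^ 2 + ∑ i, v i ^ 2) := by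
        rw [Measure.volume_eq_prod, lintegral_prod _ (by fun_prop)]
    _ = ∫⁻ t, ∫⁻ v : EuclideanSpace ℝ (Fin (m + 1)), G t √(t ^ 2 + ‖v‖ ^ 2) := by
        refine lintegral_congr fun t ↦ ?_
        rw [← (PiLp.volume_preserving_toLp (Fin (m + 1))).lintegral_comp_emb
          (MeasurableEquiv.toLp 2 _).measurableEmbedding]
        simp [EuclideanSpace.norm_sq_eq]
    _ = _ := by
        rw [← lintegral_const_mul]
        · refine lintegral_congr fun t ↦ ?_
          rw [lintegral_comp_norm_addHaar volume (f := fun r ↦ G t √(t ^ 2 + r ^ 2))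
            (by fun_prop)]
          simp
        · exact Measurable.lintegral_prod_right' (f := fun p : ℝ × ℝ ↦
            ENNReal.ofReal (p.2 ^ m) * G p.1 √(p.1 ^ 2 + p.2 ^ 2)) (by fun_prop)

lemma lintegral_ball_cos_angle (m : ℕ) : ∃ C : ℝ≥0∞, ∀ g : ℝ → ℝ≥0∞, Measurable g →
    ∫⁻ x in ball (0 : EuclideanSpace ℝ (Fin (m + 2))) 1, g (x 0 / ‖x‖) =
      C * ∫⁻ θ in Ioo 0 Real.pi, ENNReal.ofReal (Real.sin θ ^ m) * g (Real.cos θ) := by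
  refine ⟨(volume : Measure (EuclideanSpace ℝ (Fin (m + 1)))).toSphere univ *
    ∫⁻ ρ in Ioi (0 : ℝ), (Iio (1 : ℝ)).indicator (fun ρ ↦ ENNReal.ofReal (ρ ^ (m + 1))) ρ,
    fun g hg ↦ ?_⟩
  set G : ℝ → ℝ → ℝ≥0∞ := fun t ρ ↦ (Iio (1 : ℝ)).indicator (fun _ ↦ 1) ρ * g (t / ρ) with hG
  have hGm : Measurable fun p : ℝ × ℝ ↦ G p.1 p.2 :=
    ((measurable_const.indicator measurableSet_Iio).comp measurable_snd).mul (by fun_prop)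
  have h1 : ∫⁻ x in ball (0 : EuclideanSpace ℝ (Fin (m + 2))) 1, g (x 0 / ‖x‖) =
      ∫⁻ x : EuclideanSpace ℝ (Fin (m + 2)), G (x 0) ‖x‖ := by
    rw [← lintegral_indicator measurableSet_ball]
    refine lintegral_congr fun x ↦ ?_
    by_cases hx : ‖x‖ < 1 <;> simp [hG, hx]
  rw [h1, lintegral_cylindrical m (G := G) hGm, mul_assoc]
  congr 1
  have hI : Measurable ((Ioi (0 : ℝ)).indicator fun r ↦ ENNReal.ofReal (r ^ m)) :=
    Measurable.indicator (by fun_prop) measurableSet_Ioi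
  set F : ℝ × ℝ → ℝ≥0∞ := fun p ↦
    (Ioi (0 : ℝ)).indicator (fun r ↦ ENNReal.ofReal (r ^ m)) p.2 * G p.1 √(p.1 ^ 2 + p.2 ^ 2)
    with hF
  have hFm : Measurable F := (hI.comp measurable_snd).mul (by fun_prop)
  have h2 : ∫⁻ t, ∫⁻ r in Ioi (0 : ℝ), ENNReal.ofReal (r ^ m) * G t √(t ^ 2 + r ^ 2) =
      ∫⁻ p, F p := by
    rw [Measure.volume_eq_prod, lintegral_prod _ hFm.aemeasurable]
    refine lintegral_congr fun t ↦ ?_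
    rw [← lintegral_indicator measurableSet_Ioi]
    refine lintegral_congr fun r ↦ ?_
    by_cases hr : 0 < r <;> simp [hF, hr]
  have h3 (ρ : ℝ) (hρ : 0 < ρ) (θ : ℝ) (hθ : θ ∈ Ioo (-Real.pi) Real.pi) :
      ENNReal.ofReal ρ • F (polarCoord.symm (ρ, θ)) =
        (Iio (1 : ℝ)).indicator (fun ρ ↦ ENNReal.ofReal (ρ ^ (m + 1))) ρ *
        (Ioo 0 Real.pi).indicator
          (fun θ ↦ ENNReal.ofReal (Real.sin θ ^ m) * g (Real.cos θ)) θ := by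
    have hn : √((ρ * Real.cos θ) ^ 2 + (ρ * Real.sin θ) ^ 2) = ρ := by
      rw [show (ρ * Real.cos θ) ^ 2 + (ρ * Real.sin θ) ^ 2 = ρ ^ 2 by
        linear_combination ρ ^ 2 * Real.sin_sq_add_cos_sq θ, Real.sqrt_sq hρ.le]
    by_cases h : 0 < θ
    · have hs := Real.sin_pos_of_mem_Ioo ⟨h, hθ.2⟩
      by_cases h' : ρ < 1
      · have : ENNReal.ofReal (ρ ^ (m + 1)) = ENNReal.ofReal ρ * ENNReal.ofReal (ρ ^ m) := by
          rw [← ENNReal.ofReal_mul hρ.le, pow_succ']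
        simp [hF, hG, hn, h, hθ.2, hs, hρ, h', mul_pow ρ (Real.sin θ) m, hρ.ne', this, mul_assoc,
          ENNReal.ofReal_mul (pow_nonneg hρ.le m)]
      · simp [hF, hG, hn, h']
    · have hs : Real.sin θ ≤ 0 := Real.sin_nonpos_of_nonpos_of_neg_pi_le (not_lt.1 h) hθ.1.le
      have : ¬ 0 < ρ * Real.sin θ := not_lt.2 (mul_nonpos_of_nonneg_of_nonpos hρ.le hs)
      simp [hF, h, this]
  rw [h2, ← lintegral_comp_polarCoord_symm, polarCoord_target,
    setLIntegral_congr_fun (measurableSet_Ioi.prod measurableSet_Ioo)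
      (fun p hp ↦ h3 p.1 hp.1 p.2 hp.2), Measure.volume_eq_prod, ← Measure.prod_restrict,
    lintegral_prod_mul]
  · congr 1
    rw [lintegral_indicator measurableSet_Ioo, Measure.restrict_restrict measurableSet_Ioo,
      inter_eq_left.2 (Ioo_subset_Ioo_left (by linarith [Real.pi_pos]))]
  · exact (Measurable.indicator (by fun_prop) measurableSet_Iio).aemeasurable
  · exact (Measurable.indicator (by fun_prop) measurableSet_Ioo).aemeasurable

/-- Restricting the Hausdorff measure to the unit sphere gives an isometry-invariant measure. -/
lemma measurePreserving_hausdorffMeasure_restrict_sphere {E : Type*} [NormedAddCommGroup E]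
    [InnerProductSpace ℝ E] [MeasurableSpace E] [BorelSpace E] (d : ℝ) (T : E ≃ₗᵢ[ℝ] E) :
    MeasurePreserving T ((μH[d] : Measure E).restrict (sphere 0 1))
      ((μH[d] : Measure E).restrict (sphere 0 1)) := by
  simpa using (T.toIsometryEquiv.measurePreserving_hausdorffMeasure d).restrict_preimage_emb
    T.toHomeomorph.measurableEmbedding (sphere 0 1)

lemma integral_half_abs_cos_mul_sin_pow (m : ℕ) :
    ∫ θ in (0 : ℝ)..Real.pi, Real.sin θ ^ m * (|Real.cos θ| / 2) = 1 / (m + 1) := by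
  have hm : (m : ℝ) + 1 ≠ 0 := by positivity
  have hd (θ : ℝ) : HasDerivAt (fun θ ↦ Real.sin θ ^ (m + 1) / (2 * (m + 1)))
      (Real.sin θ ^ m * (Real.cos θ / 2)) θ := by
    refine (((Real.hasDerivAt_sin θ).pow (m + 1)).div_const _).congr_deriv ?_
    push_cast
    field_simp
  have hc : Continuous fun θ ↦ Real.sin θ ^ m * (Real.cos θ / 2) := by fun_prop
  have hc' : Continuous fun θ ↦ Real.sin θ ^ m * (|Real.cos θ| / 2) := by fun_prop
  have hpi := Real.pi_pos
  rw [← intervalIntegral.integral_add_adjacent_intervals (b := Real.pi / 2)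
    (hc'.intervalIntegrable _ _) (hc'.intervalIntegrable _ _)]
  have h1 : ∫ θ in (0 : ℝ)..Real.pi / 2, Real.sin θ ^ m * (|Real.cos θ| / 2) =
      ∫ θ in (0 : ℝ)..Real.pi / 2, Real.sin θ ^ m * (Real.cos θ / 2) := by
    refine intervalIntegral.integral_congr fun θ hθ ↦ ?_
    rw [uIcc_of_le (by positivity)] at hθ
    simp only [abs_of_nonneg (Real.cos_nonneg_of_mem_Icc ⟨by linarith [hθ.1], hθ.2⟩)]
  have h2 : ∫ θ in (Real.pi / 2)..Real.pi, Real.sin θ ^ m * (|Real.cos θ| / 2) =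
      ∫ θ in (Real.pi / 2)..Real.pi, -(Real.sin θ ^ m * (Real.cos θ / 2)) := by
    refine intervalIntegral.integral_congr fun θ hθ ↦ ?_
    rw [uIcc_of_le (by linarith)] at hθ
    simp only [abs_of_nonpos (Real.cos_nonpos_of_pi_div_two_le_of_le hθ.1 (by linarith [hθ.2]))]
    ring
  rw [h1, h2, intervalIntegral.integral_neg,
    intervalIntegral.integral_eq_sub_of_hasDerivAt (fun θ _ ↦ hd θ) (hc.intervalIntegrable _ _),
    intervalIntegral.integral_eq_sub_of_hasDerivAt (fun θ _ ↦ hd θ) (hc.intervalIntegrable _ _)]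
  simp
  field_simp
  norm_num

lemma integral_half_sin_half_mul_cos_half_pow (m : ℕ) :
    ∫ θ in (0 : ℝ)..Real.pi, Real.sin (θ / 2) / 2 * Real.cos (θ / 2) ^ m = 1 / (m + 1) := by
  have hm : (m : ℝ) + 1 ≠ 0 := by positivity
  have hd (θ : ℝ) : HasDerivAt (fun θ ↦ -Real.cos (θ / 2) ^ (m + 1) / (m + 1))
      (Real.sin (θ / 2) / 2 * Real.cos (θ / 2) ^ m) θ := by
    refine ((((((hasDerivAt_id θ).div_const 2).cos).pow (m + 1)).neg).div_const _).congr_deriv ?_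
    push_cast
    simp only [id]
    field_simp
  have hc : Continuous fun θ ↦ Real.sin (θ / 2) / 2 * Real.cos (θ / 2) ^ m := by fun_prop
  rw [intervalIntegral.integral_eq_sub_of_hasDerivAt (fun θ _ ↦ hd θ) (hc.intervalIntegrable _ _)]
  simp
  field_simp

lemma lintegral_Ioo_ofReal_eq_of_continuous {f : ℝ → ℝ} (hf : Continuous f) {a b : ℝ}
    (hab : a ≤ b) (h0 : ∀ x ∈ Ioo a b, 0 ≤ f x) :
    ∫⁻ x in Ioo a b, ENNReal.ofReal (f x) = ENNReal.ofReal (∫ x in a..b, f x) := by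
  rw [intervalIntegral.integral_of_le hab, integral_Ioc_eq_integral_Ioo,
    ofReal_integral_eq_lintegral_ofReal]
  · exact (hf.integrableOn_Icc).mono_set Ioo_subset_Icc_self
  · exact (ae_restrict_iff' measurableSet_Ioo).2 (.of_forall h0)

lemma sin_pow_mul_kernel (m : ℕ) {θ : ℝ} (hθ : θ ∈ Ioo 0 Real.pi) :
    Real.sin θ ^ m * ((1 - Real.cos θ) ^ 2 / √(2 - 2 * Real.cos θ) ^ (m + 3)) =
      Real.sin (θ / 2) / 2 * Real.cos (θ / 2) ^ m := by
  have hs : 0 < Real.sin (θ / 2) :=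
    Real.sin_pos_of_mem_Ioo ⟨by linarith [hθ.1], by linarith [hθ.1, hθ.2]⟩
  have hcos : Real.cos θ = 1 - 2 * Real.sin (θ / 2) ^ 2 := by
    have h1 := Real.cos_sq' (θ / 2)
    have h2 := Real.cos_two_mul (θ / 2)
    rw [mul_div_cancel₀ _ two_ne_zero] at h2
    rw [h2, h1]; ring
  have hsin : Real.sin θ = 2 * Real.sin (θ / 2) * Real.cos (θ / 2) := by
    rw [← Real.sin_two_mul, mul_div_cancel₀ _ two_ne_zero]
  have hsqrt : √(2 - 2 * Real.cos θ) = 2 * Real.sin (θ / 2) := by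
    rw [show 2 - 2 * Real.cos θ = (2 * Real.sin (θ / 2)) ^ 2 by rw [hcos]; ring,
      Real.sqrt_sq (by positivity)]
  rw [hsqrt, hsin, hcos]
  field_simp
  ring

/-- The energy kernel and `|t| / 2` have the same zonal integral. -/
lemma lintegral_sphere_kernel_eq (m : ℕ) {σ : Measure (EuclideanSpace ℝ (Fin (m + 2)))}
    [IsFiniteMeasure σ]
    (hσ : ∀ T : EuclideanSpace ℝ (Fin (m + 2)) ≃ₗᵢ[ℝ] EuclideanSpace ℝ (Fin (m + 2)),
      MeasurePreserving T σ σ)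
    (hs : ∀ᵐ x ∂σ, x ∈ sphere (0 : EuclideanSpace ℝ (Fin (m + 2))) 1)
    {e : EuclideanSpace ℝ (Fin (m + 2))} (he : e = EuclideanSpace.single 0 1) :
    ∫⁻ x, ENNReal.ofReal ((1 - ⟪x, e⟫) ^ 2 / √(2 - 2 * ⟪x, e⟫) ^ (m + 3)) ∂σ =
      ∫⁻ x, ENNReal.ofReal (|⟪x, e⟫| / 2) ∂σ := by
  have hx (x : EuclideanSpace ℝ (Fin (m + 2))) : ⟪x, e⟫ = x 0 := by
    simp [he, EuclideanSpace.inner_single_right]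
  obtain ⟨C, hC⟩ := lintegral_ball_cos_angle m
  have hpi := Real.pi_pos
  have hpos : volume (ball (0 : EuclideanSpace ℝ (Fin (m + 2))) 1) ≠ 0 :=
    (measure_ball_pos _ _ one_pos).ne'
  rw [← ENNReal.mul_left_inj hpos measure_ball_lt_top.ne,
    lintegral_sphere_inner_mul_volume_ball hσ hs
      (g := fun t ↦ ENNReal.ofReal ((1 - t) ^ 2 / √(2 - 2 * t) ^ (m + 3))) (by fun_prop)
      (by simp [he]),
    lintegral_sphere_inner_mul_volume_ball hσ hs
      (g := fun t ↦ ENNReal.ofReal (|t| / 2)) (by fun_prop) (by simp [he])]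
  simp only [hx]
  rw [hC (fun t ↦ ENNReal.ofReal ((1 - t) ^ 2 / √(2 - 2 * t) ^ (m + 3))) (by fun_prop),
    hC (fun t ↦ ENNReal.ofReal (|t| / 2)) (by fun_prop)]
  congr 2
  have hsin (θ : ℝ) (hθ : θ ∈ Ioo 0 Real.pi) : 0 ≤ Real.sin θ ^ m :=
    pow_nonneg (Real.sin_pos_of_mem_Ioo hθ).le m
  have hleft (θ : ℝ) (hθ : θ ∈ Ioo 0 Real.pi) : ENNReal.ofReal (Real.sin θ ^ m) *
      ENNReal.ofReal ((1 - Real.cos θ) ^ 2 / √(2 - 2 * Real.cos θ) ^ (m + 3)) =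
      ENNReal.ofReal (Real.sin (θ / 2) / 2 * Real.cos (θ / 2) ^ m) := by
    rw [← ENNReal.ofReal_mul (hsin θ hθ), sin_pow_mul_kernel m hθ]
  rw [setLIntegral_congr_fun measurableSet_Ioo hleft,
    setLIntegral_congr_fun measurableSet_Ioo
      (fun θ hθ ↦ (ENNReal.ofReal_mul (hsin θ hθ)).symm),
    lintegral_Ioo_ofReal_eq_of_continuous (by fun_prop) hpi.le,
    lintegral_Ioo_ofReal_eq_of_continuous (by fun_prop) hpi.le,
    integral_half_abs_cos_mul_sin_pow, integral_half_sin_half_mul_cos_half_pow]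
  · exact fun θ hθ ↦ mul_nonneg (hsin θ hθ) (by positivity)
  · intro θ hθ
    have h1 := Real.sin_pos_of_mem_Ioo (x := θ / 2)
      ⟨by linarith [hθ.1], by linarith [hθ.1, hθ.2]⟩
    have h2 := Real.cos_pos_of_mem_Ioo (x := θ / 2)
      ⟨by linarith [hθ.1], by linarith [hθ.2]⟩
    positivity

/-- For `n ≥ 2`,
`∫_{S^{n-1}} ∫_{S^{n-1}} (1 - ⟨x,y⟩)² / ‖x-y‖^{n+1} dσ(x) dσ(y) = c_n · σ(S^{n-1})`,
where `c_n = (1/2) ∫_{S^{n-1}} |w₁| dσ(w)`; i.e. the main inequality holds with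
equality for the unit ball. -/
theorem statement8 (n : ℕ) (hn : 2 ≤ n) :
    (∫ y in Metric.sphere (0 : EuclideanSpace ℝ (Fin n)) 1,
        ∫ x in Metric.sphere (0 : EuclideanSpace ℝ (Fin n)) 1,
          (1 - ⟪x, y⟫) ^ 2 / ‖x - y‖ ^ (n + 1)
        ∂(μH[(n : ℝ) - 1]) ∂(μH[(n : ℝ) - 1]))
      = ((1 : ℝ) / 2 *
          ∫ w in Metric.sphere (0 : EuclideanSpace ℝ (Fin n)) 1,
            |w ⟨0, by omega⟩| ∂(μH[(n : ℝ) - 1]))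
        * (μH[(n : ℝ) - 1] (Metric.sphere (0 : EuclideanSpace ℝ (Fin n)) 1)).toReal := by
  obtain ⟨m, rfl⟩ : ∃ m, n = m + 2 := ⟨n - 2, by omega⟩
  set S := sphere (0 : EuclideanSpace ℝ (Fin (m + 2))) 1 with hS
  set d : ℝ := ((m + 2 : ℕ) : ℝ) - 1
  set σ : Measure (EuclideanSpace ℝ (Fin (m + 2))) := (μH[d]).restrict S with hσ
  have hSm : MeasurableSet S := isClosed_sphere.measurableSet
  have hinv := measurePreserving_hausdorffMeasure_restrict_sphere
    (E := EuclideanSpace ℝ (Fin (m + 2))) d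
  have hsupp : ∀ᵐ x ∂σ, x ∈ S := ae_restrict_mem hSm
  set e : EuclideanSpace ℝ (Fin (m + 2)) := EuclideanSpace.single 0 1 with he
  have hinner (x : EuclideanSpace ℝ (Fin (m + 2))) : ⟪x, e⟫ = x 0 := by
    simp [he, EuclideanSpace.inner_single_right]
  have hnorm {x y : EuclideanSpace ℝ (Fin (m + 2))} (hx : x ∈ S) (hy : y ∈ S) :
      ‖x - y‖ = √(2 - 2 * ⟪x, y⟫) := by
    rw [← Real.sqrt_sq (norm_nonneg (x - y)), norm_sub_sq_real,
      mem_sphere_zero_iff_norm.1 hx, mem_sphere_zero_iff_norm.1 hy]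
    ring_nf
  set A := ∫⁻ x, ENNReal.ofReal ((1 - ⟪x, e⟫) ^ 2 / √(2 - 2 * ⟪x, e⟫) ^ (m + 3)) ∂σ with hA
  have hleft : ∀ y ∈ S, ∫ x, (1 - ⟪x, y⟫) ^ 2 / ‖x - y‖ ^ (m + 2 + 1) ∂σ = A.toReal := by
    intro y hy
    rw [integral_eq_lintegral_of_nonneg_ae (.of_forall fun x ↦ by positivity)
      (by fun_prop : Measurable _).aestronglyMeasurable, hA,
      ← lintegral_norm_inner_eq_of_norm_eq hinv
        (fun _ t ↦ ENNReal.ofReal ((1 - t) ^ 2 / √(2 - 2 * t) ^ (m + 3))) (y := y) (z := e)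
        (by rw [mem_sphere_zero_iff_norm.1 hy]; simp [he])]
    congr 1
    refine lintegral_congr_ae ?_
    filter_upwards [hsupp] with x hx
    rw [hnorm hx hy]
  have hright : (1 : ℝ) / 2 * ∫ w, |w ⟨0, by omega⟩| ∂σ =
      (∫⁻ x, ENNReal.ofReal (|⟪x, e⟫| / 2) ∂σ).toReal := by
    rw [← integral_const_mul, integral_eq_lintegral_of_nonneg_ae
      (.of_forall fun x ↦ by positivity) (by fun_prop : Measurable _).aestronglyMeasurable]
    simp only [hinner, one_div, inv_mul_eq_div]
    rfl
  rw [setIntegral_congr_fun hSm hleft, hright, setIntegral_const, smul_eq_mul, mul_comm,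
    Measure.real]
  by_cases hfin : μH[d] S = ⊤
  · simp [hfin]
  · have : IsFiniteMeasure σ := ⟨by simpa [hσ] using Ne.lt_top hfin⟩
    rw [hA, lintegral_sphere_kernel_eq m hinv hsupp he]
end
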